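/- Let β⃗ be sub-critical with fixed point p*. There exists a constant C > 0 such that for all sufficiently large n, W_1(π, ν) ≤ C n^{3/2} √(log n), where π is the ERGM(β⃗) distribution on 𝒢_n, ν is the Erdős–Rényi distribution G(n,p*) (each of the M edges present independently with probability p*), and W_1(μ,ν) = inf_Γ Σ_{e ∈ E(K_n)} ℙ_Γ(X_e ≠ Y_e), the infimum taken over all couplings Γ of μ and ν. -/

import Mathlib

open Finset MeasureTheory Filter
open scoped ENNReal NNReal

namespace ERGM

/-- The set of edges of the complete graph on `Fin n`: non-diagonal unordered pairs. -/
abbrev EdgeSet (n : ℕ) : Type := {p : Sym2 (Fin n) // ¬ p.IsDiag}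

/-- A configuration (graph on `n` vertices): an assignment of `true/false` to each edge. -/
abbrev Config (n : ℕ) : Type := EdgeSet n → Bool

/-- The value of the configuration `x` on the (unordered) pair `{i,j}`; `false` for `i = j`. -/
noncomputable def edgeVal {n : ℕ} (x : Config n) (i j : Fin n) : Bool :=
  if h : (s(i, j) : Sym2 (Fin n)).IsDiag then false else x ⟨s(i, j), h⟩

/-- Real-valued indicator of presence of the edge `{i,j}` in `x`. -/
noncomputable def edgeInd {n : ℕ} (x : Config n) (i j : Fin n) : ℝ :=
  if edgeVal x i j = true then 1 else 0

open scoped Classical in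
/-- Subgraph counting number `N_G(x)`: the number of copies of `G` in `x` (times the
number of automorphisms), i.e. the sum over injective `ψ` of the product of edge
indicators (each edge indicator is idempotent, so counting ordered adjacent pairs
yields the same value as counting edges). -/
noncomputable def NG {n m : ℕ} (G : SimpleGraph (Fin m)) (x : Config n) : ℝ :=
  ∑ ψ : Fin m ↪ Fin n, ∏ a : Fin m, ∏ b : Fin m,
    if G.Adj a b then edgeInd x (ψ a) (ψ b) else 1

/-- The Hamiltonian `H(x) = Σ_i β_i N_{G_i}(x) / n^{|V_i|-2}`. -/
noncomputable def Hamiltonian {n s : ℕ} (V : Fin s → ℕ)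
    (G : ∀ i, SimpleGraph (Fin (V i))) (β : Fin s → ℝ) (x : Config n) : ℝ :=
  ∑ i, β i * NG (G i) x / (n : ℝ) ^ (V i - 2)

/-- The ERGM probability mass function `π(x) ∝ exp(H(x))`. -/
noncomputable def ergmProb {n s : ℕ} (V : Fin s → ℕ)
    (G : ∀ i, SimpleGraph (Fin (V i))) (β : Fin s → ℝ) (x : Config n) : ℝ :=
  Real.exp (Hamiltonian V G β x) / ∑ y : Config n, Real.exp (Hamiltonian V G β y)

/-- Expectation of `f` with respect to the mass function `w`. -/
noncomputable def expect {n : ℕ} (w : Config n → ℝ) (f : Config n → ℝ) : ℝ :=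
  ∑ x : Config n, w x * f x

open scoped Classical in
/-- Probability of the event `A` with respect to the mass function `w`. -/
noncomputable def prob {n : ℕ} (w : Config n → ℝ) (A : Config n → Prop) : ℝ :=
  ∑ x : Config n, if A x then w x else 0

/-- The number of edges `|E(G)|` of a finite graph. -/
noncomputable def numEdges {m : ℕ} (G : SimpleGraph (Fin m)) : ℕ := G.edgeSet.ncard

/-- `Ψ_β(p) = Σ_i 2 β_i |E_i| p^{|E_i|-1}`. -/
noncomputable def Psi {s : ℕ} (V : Fin s → ℕ) (G : ∀ i, SimpleGraph (Fin (V i)))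
    (β : Fin s → ℝ) (p : ℝ) : ℝ :=
  ∑ i, 2 * β i * (numEdges (G i) : ℝ) * p ^ (numEdges (G i) - 1)

/-- `Φ(u) = e^u / (1 + e^u)`. -/
noncomputable def Phi (u : ℝ) : ℝ := Real.exp u / (1 + Real.exp u)

/-- `φ_β(p) = Φ(Ψ_β(p))`. -/
noncomputable def phiFn {s : ℕ} (V : Fin s → ℕ) (G : ∀ i, SimpleGraph (Fin (V i)))
    (β : Fin s → ℝ) : ℝ → ℝ := fun p => Phi (Psi V G β p)

/-- `β` is sub-critical (high temperature) with fixed point `p`: `p` is the unique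
solution of `φ_β(p) = p` and it satisfies `φ_β'(p) < 1`. -/
def Subcritical {s : ℕ} (V : Fin s → ℕ) (G : ∀ i, SimpleGraph (Fin (V i)))
    (β : Fin s → ℝ) (p : ℝ) : Prop :=
  phiFn V G β p = p ∧ (∀ q : ℝ, phiFn V G β q = q → q = p) ∧
    deriv (phiFn V G β) p < 1

/-- The discrete derivative `∂_e H(x) = H(x_{e+}) - H(x_{e-})`. -/
noncomputable def dHam {n s : ℕ} (V : Fin s → ℕ) (G : ∀ i, SimpleGraph (Fin (V i)))
    (β : Fin s → ℝ) (e : EdgeSet n) (x : Config n) : ℝ :=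
  Hamiltonian V G β (Function.update x e true) - Hamiltonian V G β (Function.update x e false)

/-- Real-valued indicator `X_e` of presence of edge `e`. -/
noncomputable def edgeX {n : ℕ} (e : EdgeSet n) (x : Config n) : ℝ := if x e = true then 1 else 0

/-- Two edges of `K_n` share a vertex. -/
def ShareVertex {n : ℕ} (e f : EdgeSet n) : Prop := ∃ v : Fin n, v ∈ e.1 ∧ v ∈ f.1

/-- The Erdős–Rényi `G(n,p)` probability mass function: each edge present
independently with probability `p`. -/
noncomputable def erProb {n : ℕ} (p : ℝ) (x : Config n) : ℝ :=
  ∏ e : EdgeSet n, if x e = true then p else 1 - p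

section Coupling

variable {ι : Type*} [Fintype ι] [DecidableEq ι]

/-- Summing over configurations can be done by pairing the two values of one coordinate. -/
theorem sum_eq_half_sum_update (F : (ι → Bool) → ℝ) (e : ι) :
    ∑ x, F x = 2⁻¹ * ∑ x, (F (Function.update x e true) + F (Function.update x e false)) := by
  let flip : (ι → Bool) → (ι → Bool) := fun x => Function.update x e (!x e)
  have hflip : Function.Involutive flip := by
    intro x
    simp [flip]
  have h1 : ∑ x, F (flip x) = ∑ x, F x :=
    Equiv.sum_comp (Function.Involutive.toPerm flip hflip) F
  have h2 : ∀ x, F (Function.update x e true) + F (Function.update x e false)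
      = F x + F (flip x) := by
    intro x
    rcases hx : x e with _ | _
    · have : Function.update x e false = x := by rw [← hx, Function.update_eq_self]
      simp [flip, hx, this, add_comm]
    · have : Function.update x e true = x := by rw [← hx, Function.update_eq_self]
      simp [flip, hx, this]
  simp_rw [h2, Finset.sum_add_distrib, h1]
  ring

/-- `q e x` is the conditional probability under the weights `w` that coordinate `e` is `true`,
given the values of `x` at the other coordinates. -/
structure IsCondProb (w : (ι → Bool) → ℝ) (q : ι → (ι → Bool) → ℝ) : Prop where
  nonneg : ∀ e x, 0 ≤ q e x
  le_one : ∀ e x, q e x ≤ 1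
  update : ∀ e x b, q e (Function.update x e b) = q e x
  balance : ∀ e x, w (Function.update x e true) * (1 - q e x)
    = w (Function.update x e false) * q e x

/-- The optimal coupling of two Bernoulli laws with parameters `q` and `p`. -/
noncomputable def bernoulliCoupling (q p : ℝ) : Bool → Bool → ℝ
  | true, true => min q p
  | true, false => q - min q p
  | false, true => p - min q p
  | false, false => 1 - q - p + min q p

theorem bernoulliCoupling_nonneg {q p : ℝ} (hq : 0 ≤ q) (hq1 : q ≤ 1) (hp : 0 ≤ p) (hp1 : p ≤ 1)
    (a b : Bool) : 0 ≤ bernoulliCoupling q p a b := by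
  rcases a with _ | _ <;> rcases b with _ | _ <;> simp only [bernoulliCoupling]
  · rcases min_cases q p with h | h <;> linarith
  · linarith [min_le_right q p]
  · linarith [min_le_left q p]
  · exact le_min hq hp

/-- Forget the values at `e` of a pair of configurations distributed according to `γ`, and draw
them again from the optimal coupling of their conditional laws. -/
noncomputable def resample (γ : (ι → Bool) × (ι → Bool) → ℝ) (q : ι → (ι → Bool) → ℝ) (p : ℝ)
    (e : ι) (z : (ι → Bool) × (ι → Bool)) : ℝ :=
  (γ (Function.update z.1 e true, Function.update z.2 e true)
    + γ (Function.update z.1 e true, Function.update z.2 e false)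
    + γ (Function.update z.1 e false, Function.update z.2 e true)
    + γ (Function.update z.1 e false, Function.update z.2 e false))
    * bernoulliCoupling (q e z.1) p (z.1 e) (z.2 e)

theorem sum_resample_right {w : (ι → Bool) → ℝ} {q : ι → (ι → Bool) → ℝ} (hq : IsCondProb w q)
    (p : ℝ) {γ : (ι → Bool) × (ι → Bool) → ℝ} (hγ : ∀ x, ∑ y, γ (x, y) = w x) (e : ι)
    (x : ι → Bool) : ∑ y, resample γ q p e (x, y) = w x := by
  have hb := hq.balance e x
  have key : ∑ y, resample γ q p e (x, y)
      = (w (Function.update x e true) + w (Function.update x e false))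
        * (if x e then q e x else 1 - q e x) := by
    rw [← hγ, ← hγ, sum_eq_half_sum_update _ e, sum_eq_half_sum_update (fun y => γ (_, y)) e,
      sum_eq_half_sum_update (fun y => γ (Function.update x e false, y)) e, ← mul_add,
      ← Finset.sum_add_distrib, mul_assoc, Finset.sum_mul]
    congr 1
    refine Finset.sum_congr rfl fun y _ => ?_
    rcases hx : x e with _ | _ <;> simp [resample, hx, bernoulliCoupling] <;> ring
  rw [key]
  rcases hx : x e with _ | _
  · have : Function.update x e false = x := by rw [← hx, Function.update_eq_self]
    rw [this] at hb ⊢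
    simp only [Bool.false_eq_true, if_false]
    linarith
  · have : Function.update x e true = x := by rw [← hx, Function.update_eq_self]
    rw [this] at hb ⊢
    simp only [if_true]
    linarith

theorem sum_resample_left {w v : (ι → Bool) → ℝ} {q : ι → (ι → Bool) → ℝ} (hq : IsCondProb w q)
    {p : ℝ} (hp : IsCondProb v fun _ _ => p) {γ : (ι → Bool) × (ι → Bool) → ℝ}
    (hγ : ∀ y, ∑ x, γ (x, y) = v y) (e : ι) (y : ι → Bool) :
    ∑ x, resample γ q p e (x, y) = v y := by
  have hb := hp.balance e y
  have key : ∑ x, resample γ q p e (x, y)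
      = (v (Function.update y e true) + v (Function.update y e false))
        * (if y e then p else 1 - p) := by
    rw [← hγ, ← hγ, sum_eq_half_sum_update _ e, sum_eq_half_sum_update (fun x => γ (x, _)) e,
      sum_eq_half_sum_update (fun x => γ (x, Function.update y e false)) e, ← mul_add,
      ← Finset.sum_add_distrib, mul_assoc, Finset.sum_mul]
    congr 1
    refine Finset.sum_congr rfl fun x _ => ?_
    rcases hx : y e with _ | _ <;> simp [resample, hx, bernoulliCoupling, hq.update] <;> ring
  rw [key]
  rcases hx : y e with _ | _
  · have : Function.update y e false = y := by rw [← hx, Function.update_eq_self]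
    rw [this] at hb ⊢
    simp only [Bool.false_eq_true, if_false]
    linarith
  · have : Function.update y e true = y := by rw [← hx, Function.update_eq_self]
    rw [this] at hb ⊢
    simp only [if_true]
    linarith

theorem sum_prod_eq_quarter_sum_update (F : (ι → Bool) × (ι → Bool) → ℝ) (e : ι) :
    ∑ z, F z = 4⁻¹ * ∑ z : (ι → Bool) × (ι → Bool),
      (F (Function.update z.1 e true, Function.update z.2 e true)
        + F (Function.update z.1 e true, Function.update z.2 e false)
        + F (Function.update z.1 e false, Function.update z.2 e true)
        + F (Function.update z.1 e false, Function.update z.2 e false)) := by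
  rw [Fintype.sum_prod_type, Fintype.sum_prod_type, sum_eq_half_sum_update _ e]
  have h : ∀ x, ∑ y, F (x, y) = 2⁻¹ * ∑ y, (F (x, Function.update y e true)
      + F (x, Function.update y e false)) := fun x => sum_eq_half_sum_update _ e
  simp_rw [h, ← mul_add, ← Finset.mul_sum, ← Finset.sum_add_distrib]
  rw [← mul_assoc]
  norm_num [add_assoc]

theorem disagreement_resample_of_ne {q : ι → (ι → Bool) → ℝ} (hq : ∀ e x b,
      q e (Function.update x e b) = q e x) (p : ℝ)
    (γ : (ι → Bool) × (ι → Bool) → ℝ) {e f : ι} (hef : f ≠ e) :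
    (∑ z : (ι → Bool) × (ι → Bool), if z.1 f ≠ z.2 f then resample γ q p e z else 0)
      = ∑ z : (ι → Bool) × (ι → Bool), if z.1 f ≠ z.2 f then γ z else 0 := by
  rw [sum_prod_eq_quarter_sum_update _ e,
    sum_prod_eq_quarter_sum_update (fun z => if z.1 f ≠ z.2 f then γ z else 0) e]
  congr 1
  refine Finset.sum_congr rfl fun z _ => ?_
  by_cases h : z.1 f = z.2 f
  · simp [hef, h]
  · simp [hef, h, resample, bernoulliCoupling, hq]
    ring

theorem disagreement_resample_self {w : (ι → Bool) → ℝ} {q : ι → (ι → Bool) → ℝ}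
    (hq : IsCondProb w q) (p : ℝ) {γ : (ι → Bool) × (ι → Bool) → ℝ}
    (hγ : ∀ x, ∑ y, γ (x, y) = w x) (e : ι) :
    (∑ z : (ι → Bool) × (ι → Bool), if z.1 e ≠ z.2 e then resample γ q p e z else 0)
      = ∑ x, w x * |q e x - p| := by
  have h : ∑ x, w x * |q e x - p|
      = ∑ z : (ι → Bool) × (ι → Bool), γ z * |q e z.1 - p| := by
    rw [Fintype.sum_prod_type]
    refine Finset.sum_congr rfl fun x _ => ?_
    rw [← hγ, Finset.sum_mul]
  rw [h, sum_prod_eq_quarter_sum_update _ e,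
    sum_prod_eq_quarter_sum_update (fun z => γ z * |q e z.1 - p|) e]
  congr 1
  refine Finset.sum_congr rfl fun z _ => ?_
  have habs : q e z.1 - min (q e z.1) p + (p - min (q e z.1) p) = |q e z.1 - p| := by
    rcases le_total (q e z.1) p with h | h
    · rw [min_eq_left h, abs_of_nonpos (by linarith)]; ring
    · rw [min_eq_right h, abs_of_nonneg (by linarith)]; ring
  simp only [Function.update_self, ne_eq, not_true_eq_false, if_false, resample,
    Function.update_idem, bernoulliCoupling, hq.update, ← habs, Bool.true_eq_false,
    Bool.false_eq_true, not_false_eq_true, if_true]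
  ring

/-- A law on configurations can be coupled to a product Bernoulli law so that each coordinate
disagrees with probability at most the mean distance between the conditional probabilities. -/
theorem exists_coupling {w v : (ι → Bool) → ℝ} (hw : ∀ x, 0 ≤ w x) (hw1 : ∑ x, w x = 1)
    (hv : ∀ x, 0 ≤ v x) (hv1 : ∑ x, v x = 1) {q : ι → (ι → Bool) → ℝ} (hq : IsCondProb w q)
    {p : ℝ} (hp : IsCondProb v fun _ _ => p) :
    ∃ γ : (ι → Bool) × (ι → Bool) → ℝ, (∀ z, 0 ≤ γ z) ∧ (∀ x, ∑ y, γ (x, y) = w x) ∧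
      (∀ y, ∑ x, γ (x, y) = v y) ∧
      ∀ e, (∑ z : (ι → Bool) × (ι → Bool), if z.1 e ≠ z.2 e then γ z else 0)
        ≤ ∑ x, w x * |q e x - p| := by
  suffices h : ∀ S : Finset ι, ∃ γ : (ι → Bool) × (ι → Bool) → ℝ, (∀ z, 0 ≤ γ z) ∧
      (∀ x, ∑ y, γ (x, y) = w x) ∧ (∀ y, ∑ x, γ (x, y) = v y) ∧
      ∀ e ∈ S, (∑ z : (ι → Bool) × (ι → Bool), if z.1 e ≠ z.2 e then γ z else 0)
        ≤ ∑ x, w x * |q e x - p| by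
    simpa using h Finset.univ
  intro S
  induction S using Finset.induction_on with
  | empty =>
    refine ⟨fun z => w z.1 * v z.2, fun z => mul_nonneg (hw _) (hv _), fun x => ?_, fun y => ?_,
      by simp⟩
    · simp [← Finset.mul_sum, hv1]
    · simp [← Finset.sum_mul, hw1]
  | insert e S _ ih =>
    obtain ⟨γ, h0, hx, hy, hS⟩ := ih
    refine ⟨resample γ q p e, fun z => ?_, sum_resample_right hq p hx e,
      sum_resample_left hq hp hy e, fun f hf => ?_⟩
    · refine mul_nonneg ?_ (bernoulliCoupling_nonneg (hq.nonneg e _) (hq.le_one e _)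
        (hp.nonneg e z.1) (hp.le_one e z.1) _ _)
      exact add_nonneg (add_nonneg (add_nonneg (h0 _) (h0 _)) (h0 _)) (h0 _)
    · by_cases hfe : f = e
      · subst hfe
        exact (disagreement_resample_self hq p hx f).le
      · rw [disagreement_resample_of_ne hq.update p γ hfe]
        exact hS f ((Finset.mem_insert.1 hf).resolve_left hfe)

end Coupling

section Concentration

theorem abs_exp_sub_exp_le (a b : ℝ) :
    |Real.exp a - Real.exp b| ≤ |a - b| * (Real.exp a + Real.exp b) := by
  wlog h : b ≤ a generalizing a b
  · rw [abs_sub_comm, abs_sub_comm a, add_comm]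
    exact this b a (le_of_not_ge h)
  rw [abs_of_nonneg (by linarith [Real.exp_le_exp.2 h]), abs_of_nonneg (by linarith)]
  have h1 : Real.exp b = Real.exp a * Real.exp (b - a) := by rw [← Real.exp_add]; ring_nf
  have h2 := Real.add_one_le_exp (b - a)
  nlinarith [Real.exp_pos a, Real.exp_pos b]

variable {ι : Type*} [Fintype ι] [DecidableEq ι]

/-- Approximate integration by parts: conditionally centred increments are nearly orthogonal to
the exponential of a function with small discrete derivatives. -/
theorem abs_sum_centred_mul_exp_le {w : (ι → Bool) → ℝ} (hw : ∀ x, 0 ≤ w x)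
    {q : ι → (ι → Bool) → ℝ} (hq : IsCondProb w q) (e : ι) {g : (ι → Bool) → ℝ}
    (hg0 : ∀ x, 0 ≤ g x) (hg1 : ∀ x, g x ≤ 1) (hg : ∀ x b, g (Function.update x e b) = g x)
    {f : (ι → Bool) → ℝ} {c : ℝ}
    (hf : ∀ x, |f (Function.update x e true) - f (Function.update x e false)| ≤ c) (θ : ℝ) :
    |∑ x, w x * (g x * ((if x e then 1 else 0) - q e x) * Real.exp (θ * f x))|
      ≤ |θ| * c * ∑ x, w x * Real.exp (θ * f x) := by
  rw [sum_eq_half_sum_update _ e, sum_eq_half_sum_update (fun x => w x * Real.exp (θ * f x)) e,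
    mul_left_comm, abs_mul, abs_of_pos (by norm_num : (0 : ℝ) < 2⁻¹), Finset.mul_sum]
  refine mul_le_mul_of_nonneg_left ?_ (by norm_num)
  refine (Finset.abs_sum_le_sum_abs _ _).trans (Finset.sum_le_sum fun x _ => ?_)
  simp only [Function.update_self, hg, hq.update, if_true, Bool.false_eq_true, if_false]
  set u := w (Function.update x e true)
  set v := w (Function.update x e false)
  set a := f (Function.update x e true)
  set b := f (Function.update x e false)
  have hb : u * (1 - q e x) = v * q e x := hq.balance e x
  have hu : 0 ≤ u := hw _
  have hv : 0 ≤ v := hw _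
  have hexp := abs_exp_sub_exp_le (θ * a) (θ * b)
  rw [← mul_sub, abs_mul] at hexp
  have h1 : u * (g x * (1 - q e x) * Real.exp (θ * a))
      + v * (g x * (0 - q e x) * Real.exp (θ * b))
      = g x * (u * (1 - q e x)) * (Real.exp (θ * a) - Real.exp (θ * b)) := by
    linear_combination g x * Real.exp (θ * b) * hb
  have hn : 0 ≤ u * (1 - q e x) := mul_nonneg hu (by linarith [hq.le_one e x])
  have hc : 0 ≤ |θ| * c := mul_nonneg (abs_nonneg _) ((abs_nonneg _).trans (hf x))
  rw [h1, abs_mul, abs_of_nonneg (mul_nonneg (hg0 x) hn)]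
  calc g x * (u * (1 - q e x)) * |Real.exp (θ * a) - Real.exp (θ * b)|
      ≤ 1 * (u * (1 - q e x)) * (|θ| * c * (Real.exp (θ * a) + Real.exp (θ * b))) := by
        refine mul_le_mul (mul_le_mul_of_nonneg_right (hg1 x) hn) (hexp.trans ?_)
          (abs_nonneg _) (by linarith)
        gcongr
        exact hf x
    _ = |θ| * c * (u * (1 - q e x) * Real.exp (θ * a) + v * q e x * Real.exp (θ * b)) := by
        rw [← hb]; ring
    _ ≤ |θ| * c * (u * Real.exp (θ * a) + v * Real.exp (θ * b)) := by
        refine mul_le_mul_of_nonneg_left ?_ hc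
        have h2 := hq.nonneg e x
        have h3 := hq.le_one e x
        gcongr
        · nlinarith
        · nlinarith

/-- Sub-Gaussian exponential moments for weighted sums of conditionally centred coordinates. -/
theorem sum_mul_exp_le {w : (ι → Bool) → ℝ} (hw : ∀ x, 0 ≤ w x) (hw1 : ∑ x, w x = 1)
    {q : ι → (ι → Bool) → ℝ} (hq : IsCondProb w q) {J : Type*} (s : Finset J) {κ : ℝ}
    (hκ : 0 ≤ κ) (hκs : κ * s.card ≤ 1) (a : J → ι) {g : J → (ι → Bool) → ℝ}
    (hg0 : ∀ j x, 0 ≤ g j x) (hg1 : ∀ j x, g j x ≤ 1)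
    (hg : ∀ j ∈ s, ∀ x b, g j (Function.update x (a j) b) = g j x)
    {f : (ι → Bool) → ℝ}
    (hfdef : ∀ x, f x = κ * ∑ j ∈ s, g j x * ((if x (a j) then 1 else 0) - q (a j) x))
    {c : ℝ} (hc : 0 ≤ c)
    (hf : ∀ e x, |f (Function.update x e true) - f (Function.update x e false)| ≤ c) (θ : ℝ) :
    ∑ x, w x * Real.exp (θ * f x) ≤ Real.exp (c * θ ^ 2 / 2) := by
  set m : ℝ → ℝ := fun r => ∑ x, w x * Real.exp (r * f x) with hm
  set m' : ℝ → ℝ := fun r => ∑ x, w x * (f x * Real.exp (r * f x)) with hm'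
  have hderiv : ∀ r, HasDerivAt m (m' r) r := by
    intro r
    refine HasDerivAt.fun_sum fun x _ => ?_
    have h := (((hasDerivAt_id r).mul_const (f x)).exp).const_mul (w x)
    simpa [mul_comm, mul_left_comm] using h
  have hmpos : ∀ r, 0 ≤ m r := fun r =>
    Finset.sum_nonneg fun x _ => mul_nonneg (hw x) (Real.exp_pos _).le
  have hbound : ∀ r, |m' r| ≤ |r| * c * m r := by
    intro r
    have h1 : m' r = κ * ∑ j ∈ s, ∑ x,
        w x * (g j x * ((if x (a j) then 1 else 0) - q (a j) x) * Real.exp (r * f x)) := by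
      rw [Finset.sum_comm, Finset.mul_sum]
      refine Finset.sum_congr rfl fun x _ => ?_
      rw [← Finset.mul_sum, ← Finset.sum_mul, hfdef x]
      ring
    have h2 : ∀ j ∈ s, |∑ x,
        w x * (g j x * ((if x (a j) then 1 else 0) - q (a j) x) * Real.exp (r * f x))|
        ≤ |r| * c * m r := fun j hj =>
      abs_sum_centred_mul_exp_le hw hq (a j) (hg0 j) (hg1 j) (hg j hj) (hf (a j)) r
    rw [h1, abs_mul, abs_of_nonneg hκ]
    have h3 := (Finset.abs_sum_le_sum_abs _ _).trans (Finset.sum_le_sum h2)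
    rw [Finset.sum_const, nsmul_eq_mul] at h3
    have h4 : 0 ≤ |r| * c * m r := mul_nonneg (mul_nonneg (abs_nonneg _) hc) (hmpos r)
    calc _ ≤ κ * (s.card * (|r| * c * m r)) := mul_le_mul_of_nonneg_left h3 hκ
      _ = (κ * s.card) * (|r| * c * m r) := by ring
      _ ≤ 1 * (|r| * c * m r) := mul_le_mul_of_nonneg_right hκs h4
      _ = _ := one_mul _
  set u : ℝ → ℝ := fun t => m (θ * t) * Real.exp (-(c * θ ^ 2 / 2) * t ^ 2) with hu
  have hud : ∀ t, HasDerivAt u ((m' (θ * t) * θ - c * θ ^ 2 * t * m (θ * t))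
      * Real.exp (-(c * θ ^ 2 / 2) * t ^ 2)) t := by
    intro t
    have h1 : HasDerivAt (fun t => m (θ * t)) (m' (θ * t) * θ) t :=
      (hderiv (θ * t)).comp t (by simpa using (hasDerivAt_id t).const_mul θ)
    have h2 : HasDerivAt (fun t : ℝ => Real.exp (-(c * θ ^ 2 / 2) * t ^ 2))
        (Real.exp (-(c * θ ^ 2 / 2) * t ^ 2) * (-(c * θ ^ 2 / 2) * (2 * t))) t := by
      have := ((hasDerivAt_pow 2 t).const_mul (-(c * θ ^ 2 / 2))).exp
      simpa using this
    exact (h1.mul h2).congr_deriv (by ring)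
  have hanti : AntitoneOn u (Set.Icc 0 1) := by
    refine antitoneOn_of_deriv_nonpos (convex_Icc 0 1)
      (fun t _ => (hud t).continuousAt.continuousWithinAt)
      (fun t _ => (hud t).differentiableAt.differentiableWithinAt) fun t ht => ?_
    rw [interior_Icc] at ht
    rw [(hud t).deriv]
    refine mul_nonpos_of_nonpos_of_nonneg ?_ (Real.exp_pos _).le
    have h1 := hbound (θ * t)
    rw [abs_mul, abs_of_pos ht.1] at h1
    have h2 : m' (θ * t) * θ ≤ |m' (θ * t)| * |θ| := by
      rw [← abs_mul]; exact le_abs_self _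
    have h3 := mul_le_mul_of_nonneg_right h1 (abs_nonneg θ)
    have h4 : |θ| * t * c * m (θ * t) * |θ| = c * θ ^ 2 * t * m (θ * t) := by
      rw [← sq_abs θ]; ring
    linarith
  have h := hanti (Set.left_mem_Icc.2 zero_le_one) (Set.right_mem_Icc.2 zero_le_one) zero_le_one
  have h0 : u 0 = 1 := by simp [hu, hm, hw1]
  have h1 : u 1 = m θ * Real.exp (-(c * θ ^ 2 / 2)) := by simp [hu]
  rw [h0, h1, Real.exp_neg, ← div_eq_mul_inv, div_le_one (Real.exp_pos _)] at h
  exact h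

/-- A finite family with uniformly bounded exponential moments has a common majorant with small
mean. -/
theorem exists_majorant {Ω J : Type*} [Fintype Ω] [Fintype J] {w : Ω → ℝ} (hw : ∀ x, 0 ≤ w x)
    (hw1 : ∑ x, w x = 1) (f : J → Ω → ℝ) {θ B : ℝ} (hθ : 0 < θ)
    (hB : ∀ j, ∑ x, w x * Real.exp (θ * f j x) ≤ Real.exp B)
    (hB' : ∀ j, ∑ x, w x * Real.exp (-θ * f j x) ≤ Real.exp B) :
    ∃ D : Ω → ℝ, (∀ x, 0 ≤ D x) ∧ (∀ j x, |f j x| ≤ D x) ∧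
      ∑ x, w x * D x ≤ Real.log (1 + 2 * Fintype.card J * Real.exp B) / θ := by
  set Z : Ω → ℝ := fun x => 1 + ∑ j, (Real.exp (θ * f j x) + Real.exp (-θ * f j x)) with hZ
  have hsum : ∀ x, ∀ j, Real.exp (θ * f j x) + Real.exp (-θ * f j x)
      ≤ ∑ j, (Real.exp (θ * f j x) + Real.exp (-θ * f j x)) := fun x j =>
    Finset.single_le_sum (f := fun j => Real.exp (θ * f j x) + Real.exp (-θ * f j x))
      (fun j _ => by positivity) (Finset.mem_univ j)
  have hZ1 : ∀ x, 1 ≤ Z x := fun x => by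
    have : 0 ≤ ∑ j, (Real.exp (θ * f j x) + Real.exp (-θ * f j x)) :=
      Finset.sum_nonneg fun j _ => by positivity
    simp only [hZ]; linarith
  refine ⟨fun x => Real.log (Z x) / θ, fun x => div_nonneg (Real.log_nonneg (hZ1 x)) hθ.le,
    fun j x => ?_, ?_⟩
  · rw [le_div_iff₀ hθ, Real.le_log_iff_exp_le (by linarith [hZ1 x])]
    have h := hsum x j
    have h1 := Real.exp_pos (θ * f j x)
    have h2 := Real.exp_pos (-θ * f j x)
    rcases abs_cases (f j x) with ⟨ha, _⟩ | ⟨ha, _⟩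
    · rw [ha, mul_comm]; simp only [hZ]; linarith
    · rw [ha, neg_mul, mul_comm, ← neg_mul]; simp only [hZ]; linarith
  · set L := 1 + 2 * Fintype.card J * Real.exp B with hL
    have hLpos : 0 < L := by positivity
    have hEZ : ∑ x, w x * Z x ≤ L := by
      have : ∑ x, w x * Z x = 1 + ∑ j, (∑ x, w x * Real.exp (θ * f j x)
          + ∑ x, w x * Real.exp (-θ * f j x)) := by
        simp only [hZ, mul_add, mul_one, Finset.sum_add_distrib, hw1, Finset.mul_sum]
        rw [Finset.sum_comm, Finset.sum_comm (f := fun x j => w x * Real.exp (-θ * f j x))]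
      rw [this, hL]
      have h2 : ∑ j, (∑ x, w x * Real.exp (θ * f j x) + ∑ x, w x * Real.exp (-θ * f j x))
          ≤ ∑ _j : J, (Real.exp B + Real.exp B) :=
        Finset.sum_le_sum fun j _ => add_le_add (hB j) (hB' j)
      rw [Finset.sum_const, nsmul_eq_mul, Finset.card_univ] at h2
      linarith
    have hlog : ∀ x, Real.log (Z x) ≤ Real.log L + (Z x / L - 1) := fun x => by
      have hz : 0 < Z x := by linarith [hZ1 x]
      have := Real.log_le_sub_one_of_pos (div_pos hz hLpos)
      rw [Real.log_div hz.ne' hLpos.ne'] at this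
      linarith
    have h1 : ∑ x, w x * Real.log (Z x) ≤ Real.log L := by
      calc ∑ x, w x * Real.log (Z x) ≤ ∑ x, w x * (Real.log L + (Z x / L - 1)) :=
            Finset.sum_le_sum fun x _ => mul_le_mul_of_nonneg_left (hlog x) (hw x)
        _ = (Real.log L - 1) * ∑ x, w x + (∑ x, w x * Z x) / L := by
            rw [Finset.mul_sum, Finset.sum_div, ← Finset.sum_add_distrib]
            exact Finset.sum_congr rfl fun x _ => by ring
        _ ≤ (Real.log L - 1) * 1 + 1 := by
            rw [hw1]
            gcongr
            exact (div_le_one hLpos).2 hEZ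
        _ = Real.log L := by ring
    calc ∑ x, w x * (Real.log (Z x) / θ) = (∑ x, w x * Real.log (Z x)) / θ := by
          rw [Finset.sum_div]; exact Finset.sum_congr rfl fun x _ => by ring
      _ ≤ _ := by gcongr

end Concentration

section Subgraphs

variable {m n : ℕ}

theorem edgeX_nonneg (e : EdgeSet n) (x : Config n) : 0 ≤ edgeX e x := by
  unfold edgeX; split_ifs <;> norm_num

theorem edgeX_le_one (e : EdgeSet n) (x : Config n) : edgeX e x ≤ 1 := by
  unfold edgeX; split_ifs <;> norm_num

/-- The map induced on edges by an injective map on vertices. -/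
def mapEdge (ψ : Fin m ↪ Fin n) (f : EdgeSet m) : EdgeSet n :=
  ⟨f.1.map ψ, by rw [Sym2.isDiag_map ψ.injective]; exact f.2⟩

theorem mapEdge_injective (ψ : Fin m ↪ Fin n) : Function.Injective (mapEdge ψ) := fun _ _ h =>
  Subtype.ext (Sym2.map.injective ψ.injective (Subtype.ext_iff.1 h))

/-- The indicator that all edges of `A` are present in the copy of `A` placed by `ψ`. -/
noncomputable def copyInd (A : Finset (EdgeSet m)) (ψ : Fin m ↪ Fin n) (x : Config n) : ℝ :=
  ∏ f ∈ A, edgeX (mapEdge ψ f) x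

theorem copyInd_nonneg (A : Finset (EdgeSet m)) (ψ : Fin m ↪ Fin n) (x : Config n) :
    0 ≤ copyInd A ψ x :=
  Finset.prod_nonneg fun _ _ => edgeX_nonneg _ _

theorem copyInd_le_one (A : Finset (EdgeSet m)) (ψ : Fin m ↪ Fin n) (x : Config n) :
    copyInd A ψ x ≤ 1 :=
  Finset.prod_le_one (fun _ _ => edgeX_nonneg _ _) fun _ _ => edgeX_le_one _ _

theorem edgeX_update_self (e : EdgeSet n) (x : Config n) (b : Bool) :
    edgeX e (Function.update x e b) = if b then 1 else 0 := by
  simp [edgeX]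

theorem edgeX_update_of_ne {e f : EdgeSet n} (h : f ≠ e) (x : Config n) (b : Bool) :
    edgeX f (Function.update x e b) = edgeX f x := by
  simp [edgeX, h]

theorem copyInd_update_of_forall_ne {A : Finset (EdgeSet m)} {ψ : Fin m ↪ Fin n} {e : EdgeSet n}
    (h : ∀ f ∈ A, mapEdge ψ f ≠ e) (x : Config n) (b : Bool) :
    copyInd A ψ (Function.update x e b) = copyInd A ψ x :=
  Finset.prod_congr rfl fun f hf => edgeX_update_of_ne (h f hf) x b

theorem copyInd_erase_update {A : Finset (EdgeSet m)} {ψ : Fin m ↪ Fin n} {f : EdgeSet m}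
    (x : Config n) (b : Bool) :
    copyInd (A.erase f) ψ (Function.update x (mapEdge ψ f) b) = copyInd (A.erase f) ψ x :=
  copyInd_update_of_forall_ne
    (fun _ hg h => (Finset.mem_erase.1 hg).1 (mapEdge_injective ψ h)) x b

theorem copyInd_update_sub {A : Finset (EdgeSet m)} {ψ : Fin m ↪ Fin n} {f : EdgeSet m}
    (hf : f ∈ A) (x : Config n) :
    copyInd A ψ (Function.update x (mapEdge ψ f) true)
      - copyInd A ψ (Function.update x (mapEdge ψ f) false) = copyInd (A.erase f) ψ x := by
  have h : ∀ b, copyInd A ψ (Function.update x (mapEdge ψ f) b)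
      = (if b then 1 else 0) * copyInd (A.erase f) ψ x := fun b => by
    rw [← copyInd_erase_update x b, copyInd, copyInd, ← Finset.mul_prod_erase A _ hf,
      edgeX_update_self]
  simp [h]

open scoped Classical in
/-- The edges of `G`, as edges of the complete graph. -/
noncomputable def graphEdges (G : SimpleGraph (Fin m)) : Finset (EdgeSet m) :=
  Finset.univ.filter fun f => f.1 ∈ G.edgeSet

open scoped Classical in
/-- The edges of `G` other than `{a, b}`. -/
noncomputable def otherEdges (G : SimpleGraph (Fin m)) (a b : Fin m) : Finset (EdgeSet m) :=
  (graphEdges G).filter fun f => f.1 ≠ s(a, b)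

theorem ne_of_mem_otherEdges {G : SimpleGraph (Fin m)} {a b : Fin m} {f : EdgeSet m}
    (hf : f ∈ otherEdges G a b) : f.1 ≠ s(a, b) := by
  classical
  exact (Finset.mem_filter.1 hf).2

theorem card_graphEdges (G : SimpleGraph (Fin m)) : (graphEdges G).card = numEdges G := by
  classical
  rw [numEdges, ← Set.ncard_coe_finset, ← Set.ncard_image_of_injective _ Subtype.val_injective]
  congr 1
  ext z
  simp only [graphEdges, Finset.coe_filter, Finset.mem_univ, true_and, Set.mem_image,
    Set.mem_ofPred_eq, Subtype.exists, exists_and_left, exists_prop, exists_eq_right_right]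
  exact ⟨fun h => h.1, fun h => ⟨h, G.not_isDiag_of_mem_edgeSet h⟩⟩

theorem otherEdges_eq_erase {G : SimpleGraph (Fin m)} {a b : Fin m} (h : G.Adj a b) :
    otherEdges G a b = (graphEdges G).erase ⟨s(a, b), by simpa using h.ne⟩ := by
  classical
  ext f
  simp only [otherEdges, Finset.mem_filter, Finset.mem_erase, ne_eq, Subtype.ext_iff]
  tauto

theorem card_otherEdges {G : SimpleGraph (Fin m)} {a b : Fin m} (h : G.Adj a b) :
    (otherEdges G a b).card = numEdges G - 1 := by
  classical
  rw [otherEdges_eq_erase h, Finset.card_erase_of_mem, card_graphEdges]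
  simpa [graphEdges] using h

theorem prod_indicator {J : Type*} (s : Finset J) (P : J → Prop) [DecidablePred P]
    [Decidable (∀ j ∈ s, P j)] :
    (∏ j ∈ s, if P j then (1 : ℝ) else 0) = if ∀ j ∈ s, P j then 1 else 0 := by
  rw [Finset.prod_boole]
  congr

theorem NG_eq (G : SimpleGraph (Fin m)) (x : Config n) :
    NG G x = ∑ ψ : Fin m ↪ Fin n, copyInd (graphEdges G) ψ x := by
  classical
  refine Finset.sum_congr rfl fun ψ _ => ?_
  have hL : ∀ a, (∏ b, if G.Adj a b then edgeInd x (ψ a) (ψ b) else 1)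
      = if (∀ b ∈ Finset.univ, G.Adj a b → edgeVal x (ψ a) (ψ b) = true) then (1 : ℝ) else 0 :=
    fun a => by
      rw [← prod_indicator]
      refine Finset.prod_congr rfl fun b _ => ?_
      by_cases h : G.Adj a b <;> simp [h, edgeInd]
  have hR : copyInd (graphEdges G) ψ x
      = if (∀ f ∈ graphEdges G, x (mapEdge ψ f) = true) then (1 : ℝ) else 0 := by
    rw [← prod_indicator]
    rfl
  rw [Finset.prod_congr rfl fun a _ => hL a, prod_indicator, hR]
  refine if_congr ?_ rfl rfl
  simp only [Finset.mem_univ, true_imp_iff, graphEdges, Finset.mem_filter, true_and]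
  constructor
  · rintro h ⟨f, hf⟩ hfG
    induction f using Sym2.ind with
    | _ a b =>
      have h1 := h a b hfG
      have hd : ¬ (s(ψ a, ψ b) : Sym2 (Fin n)).IsDiag := by
        simpa using hfG.ne
      simpa [edgeVal, hd, mapEdge] using h1
  · intro h a b hab
    have h1 := h ⟨s(a, b), by simpa using hab.ne⟩ hab
    have hd : ¬ (s(ψ a, ψ b) : Sym2 (Fin n)).IsDiag := by simpa using hab.ne
    simpa [edgeVal, hd, mapEdge] using h1

/-- The injective maps sending `a` to `u` and `b` to `v`. -/
noncomputable def rootedMaps (n : ℕ) (a b : Fin m) (u v : Fin n) : Finset (Fin m ↪ Fin n) :=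
  Finset.univ.filter fun ψ => ψ a = u ∧ ψ b = v

theorem mem_rootedMaps {a b : Fin m} {u v : Fin n} {ψ : Fin m ↪ Fin n} :
    ψ ∈ rootedMaps n a b u v ↔ ψ a = u ∧ ψ b = v := by
  simp [rootedMaps]

open scoped Classical in
theorem copyInd_graphEdges_update_sub (G : SimpleGraph (Fin m)) (ψ : Fin m ↪ Fin n)
    {e : EdgeSet n} {u v : Fin n} (he : e.1 = s(u, v)) (x : Config n) :
    copyInd (graphEdges G) ψ (Function.update x e true)
      - copyInd (graphEdges G) ψ (Function.update x e false)
      = ∑ a, ∑ b, if G.Adj a b then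
          (if ψ a = u ∧ ψ b = v then copyInd (otherEdges G a b) ψ x else 0) else 0 := by
  by_cases h : ∃ a b, G.Adj a b ∧ ψ a = u ∧ ψ b = v
  · obtain ⟨a, b, hab, rfl, rfl⟩ := h
    rw [Finset.sum_eq_single a, Finset.sum_eq_single b]
    · have hm : e = mapEdge ψ ⟨s(a, b), by simpa using hab.ne⟩ := Subtype.ext he
      rw [hm, copyInd_update_sub (by simpa [graphEdges] using hab)]
      simp [hab, otherEdges_eq_erase hab]
    · intro b' _ hb'
      simp [hb']
    · simp
    · intro a' _ ha'
      simp [ha']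
    · simp
  · have h0 : ∀ f ∈ graphEdges G, mapEdge ψ f ≠ e := by
      rintro ⟨f, hf⟩ hfG hfe
      rw [Subtype.ext_iff, he] at hfe
      simp only [graphEdges, Finset.mem_filter, Finset.mem_univ, true_and] at hfG
      induction f using Sym2.ind with
      | _ a b =>
        simp only [mapEdge, Sym2.map_mk, Sym2.eq_iff] at hfe
        rcases hfe with hh | hh
        · exact h ⟨a, b, hfG, hh.1, hh.2⟩
        · exact h ⟨b, a, hfG.symm, hh.2, hh.1⟩
    rw [copyInd_update_of_forall_ne h0, copyInd_update_of_forall_ne h0, sub_self]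
    symm
    refine Finset.sum_eq_zero fun a _ => Finset.sum_eq_zero fun b _ => ?_
    push Not at h
    by_cases hab : G.Adj a b
    · have := h a b hab
      simp only [hab, if_true]
      rw [if_neg]
      tauto
    · simp [hab]

/-- The normalised number of copies of `A` in `x` with `a` placed at `u` and `b` placed at `v`. -/
noncomputable def rootedDensity (A : Finset (EdgeSet m)) (a b : Fin m) (u v : Fin n)
    (x : Config n) : ℝ :=
  ((n : ℝ) ^ (m - 2))⁻¹ * ∑ ψ ∈ rootedMaps n a b u v, copyInd A ψ x

open scoped Classical in
theorem dHam_eq {s : ℕ} (V : Fin s → ℕ) (G : ∀ i, SimpleGraph (Fin (V i))) (β : Fin s → ℝ)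
    {e : EdgeSet n} {u v : Fin n} (he : e.1 = s(u, v)) (x : Config n) :
    dHam V G β e x = ∑ i, β i * ∑ a, ∑ b, if (G i).Adj a b then
      rootedDensity (otherEdges (G i) a b) a b u v x else 0 := by
  rw [dHam, Hamiltonian, Hamiltonian, ← Finset.sum_sub_distrib]
  refine Finset.sum_congr rfl fun i _ => ?_
  rw [← sub_div, ← mul_sub, NG_eq, NG_eq, ← Finset.sum_sub_distrib, mul_div_assoc]
  congr 1
  simp_rw [copyInd_graphEdges_update_sub (G i) _ he, div_eq_inv_mul, Finset.mul_sum]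
  rw [Finset.sum_comm]
  refine Finset.sum_congr rfl fun a _ => ?_
  rw [Finset.sum_comm]
  refine Finset.sum_congr rfl fun b _ => ?_
  by_cases hab : (G i).Adj a b
  · simp only [hab, if_true, rootedDensity, rootedMaps, ← Finset.mul_sum, Finset.sum_filter]
  · simp [hab]

end Subgraphs

section Counting

variable {m n : ℕ}

theorem card_filter_forall_eq (T : Finset (Fin m)) (σ : Fin m → Fin n) :
    (Finset.univ.filter fun ψ : Fin m ↪ Fin n => ∀ c ∈ T, ψ c = σ c).card
      ≤ n ^ (m - T.card) := by
  have h : (Fintype.piFinset fun c => if c ∈ T then {σ c} else (Finset.univ : Finset (Fin n))).card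
      = n ^ (m - T.card) := by
    have h1 : ∀ c, (if c ∈ T then {σ c} else (Finset.univ : Finset (Fin n))).card
        = if c ∈ T then 1 else n := fun c => by split_ifs <;> simp
    simp_rw [Fintype.card_piFinset, h1, Finset.prod_ite]
    simp [Finset.filter_not, Finset.card_sdiff]
  rw [← h]
  refine Finset.card_le_card_of_injOn (fun ψ => ψ) (fun ψ hψ => ?_)
    (fun ψ _ χ _ hh => DFunLike.coe_injective hh)
  simp only [Finset.coe_filter, Finset.mem_univ, true_and, Set.mem_ofPred_eq] at hψ
  simp only [Finset.mem_coe, Fintype.mem_piFinset]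
  intro c
  split_ifs with hc
  · simp [hψ c hc]
  · simp

theorem card_rootedMaps_le {a b : Fin m} (hab : a ≠ b) (u v : Fin n) :
    (rootedMaps n a b u v).card ≤ n ^ (m - 2) := by
  have h := card_filter_forall_eq {a, b} fun c => if c = a then u else v
  rw [Finset.card_pair hab] at h
  refine (Finset.card_le_card fun ψ hψ => ?_).trans h
  rw [mem_rootedMaps] at hψ
  simp [hψ.1, hψ.2, hab.symm]

theorem card_rootedMaps_filter_eq_le {a b c : Fin m} (hab : a ≠ b) (hca : c ≠ a) (hcb : c ≠ b)
    (u v w : Fin n) :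
    ((rootedMaps n a b u v).filter fun ψ => ψ c = w).card ≤ n ^ (m - 3) := by
  have h := card_filter_forall_eq {a, b, c} fun d => if d = a then u else if d = b then v else w
  rw [Finset.card_eq_three.2 ⟨a, b, c, hab, hca.symm, hcb.symm, rfl⟩] at h
  refine (Finset.card_le_card fun ψ hψ => ?_).trans h
  rw [Finset.mem_filter, mem_rootedMaps] at hψ
  simp [hψ.1.1, hψ.1.2, hψ.2, hab.symm, hca, hcb]

theorem card_rootedMaps_hit_le {A : Finset (EdgeSet m)} {a b : Fin m} (hab : a ≠ b)
    (hA : ∀ f ∈ A, f.1 ≠ s(a, b)) (u v : Fin n) (e : EdgeSet n) :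
    ((rootedMaps n a b u v).filter fun ψ => ∃ f ∈ A, mapEdge ψ f = e).card * n
      ≤ m * n ^ (m - 2) := by
  classical
  by_cases he : e.1 = s(u, v)
  · have h0 : ((rootedMaps n a b u v).filter fun ψ => ∃ f ∈ A, mapEdge ψ f = e) = ∅ := by
      refine Finset.filter_eq_empty_iff.2 fun ψ hψ => ?_
      rintro ⟨f, hf, hfe⟩
      rw [mem_rootedMaps] at hψ
      refine hA f hf (Sym2.map.injective ψ.injective ?_)
      rw [Sym2.map_mk, hψ.1, hψ.2, ← he, ← hfe]
      rfl
    rw [h0]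
    simp
  obtain ⟨w, hw, hwu, hwv⟩ : ∃ w, w ∈ e.1 ∧ w ≠ u ∧ w ≠ v := by
    obtain ⟨e, hd⟩ := e
    induction e using Sym2.ind with
    | _ y z =>
      have hyz : y ≠ z := by simpa using hd
      simp only [Sym2.eq_iff] at he
      by_cases h1 : y ≠ u ∧ y ≠ v
      · exact ⟨y, by simp, h1⟩
      · refine ⟨z, by simp, ?_⟩
        grind
  rcases Finset.eq_empty_or_nonempty
    ((rootedMaps n a b u v).filter fun ψ => ∃ f ∈ A, mapEdge ψ f = e) with h0 | ⟨ψ₀, hψ₀⟩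
  · rw [h0]
    simp
  have hsub : ((rootedMaps n a b u v).filter fun ψ => ∃ f ∈ A, mapEdge ψ f = e)
      ⊆ (Finset.univ.filter fun c => c ≠ a ∧ c ≠ b).biUnion fun c =>
        (rootedMaps n a b u v).filter fun ψ => ψ c = w := by
    intro ψ hψ
    rw [Finset.mem_filter] at hψ
    obtain ⟨hr, f, hf, hfe⟩ := hψ
    rw [← hfe] at hw
    obtain ⟨c, _, hc⟩ := Sym2.mem_map.1 hw
    have hr' := mem_rootedMaps.1 hr
    refine Finset.mem_biUnion.2 ⟨c, Finset.mem_filter.2 ⟨Finset.mem_univ _, ?_, ?_⟩,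
      Finset.mem_filter.2 ⟨hr, hc⟩⟩
    · rintro rfl; exact hwu (hc.symm.trans hr'.1)
    · rintro rfl; exact hwv (hc.symm.trans hr'.2)
  obtain ⟨c, hc, -⟩ := Finset.mem_biUnion.1 (hsub hψ₀)
  have hm : 3 ≤ m := by
    have hc' := (Finset.mem_filter.1 hc).2
    have := Finset.card_le_univ ({a, b, c} : Finset (Fin m))
    rwa [Finset.card_eq_three.2 ⟨a, b, c, hab, hc'.1.symm, hc'.2.symm, rfl⟩,
      Fintype.card_fin] at this
  have hcard := (Finset.card_le_card hsub).trans
    (Finset.card_biUnion_le_card_mul _ _ (n ^ (m - 3)) fun c hc =>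
      card_rootedMaps_filter_eq_le hab (Finset.mem_filter.1 hc).2.1 (Finset.mem_filter.1 hc).2.2
        u v w)
  have hle : (Finset.univ.filter fun c : Fin m => c ≠ a ∧ c ≠ b).card ≤ m := by
    simpa using Finset.card_filter_le (Finset.univ : Finset (Fin m)) fun c => c ≠ a ∧ c ≠ b
  calc _ ≤ (m * n ^ (m - 3)) * n :=
        Nat.mul_le_mul_right _ (hcard.trans (Nat.mul_le_mul_right _ hle))
    _ = m * n ^ (m - 2) := by
        rw [mul_assoc, ← pow_succ]
        congr 2
        omega

theorem descFactorial_le_card_rootedMaps {a b : Fin m} (hab : a ≠ b) {u v : Fin n}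
    (huv : u ≠ v) : (n - 2).descFactorial (m - 2) ≤ (rootedMaps n a b u v).card := by
  classical
  have hcard : ∀ {k : ℕ} {c d : Fin k}, c ≠ d → Fintype.card {z : Fin k // z ∉ ({c, d} : Finset _)}
      = k - 2 := by
    intro k c d hcd
    rw [Fintype.card_subtype_compl, Fintype.card_coe, Finset.card_pair hcd, Fintype.card_fin]
  rw [← hcard hab, ← hcard huv, ← Fintype.card_embedding_eq, ← Finset.card_univ]
  let ext : ({z : Fin m // z ∉ ({a, b} : Finset _)} ↪ {z : Fin n // z ∉ ({u, v} : Finset _)}) →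
      Fin m → Fin n := fun χ c =>
    if h : c ∉ ({a, b} : Finset _) then (χ ⟨c, h⟩ : Fin n) else if c = a then u else v
  have hext : ∀ χ, Function.Injective (ext χ) := by
    intro χ c d hcd
    have hχ : ∀ z, (χ z : Fin n) ≠ u ∧ (χ z : Fin n) ≠ v := fun z => by
      have := (χ z).2
      simpa using this
    have hinj : ∀ z z', (χ z : Fin n) = χ z' → z = z' := fun z z' h =>
      χ.injective (Subtype.ext h)
    simp only [ext] at hcd
    split_ifs at hcd with h1 h2 h3 h4 h5 h6 <;> grind
  refine Finset.card_le_card_of_injOn (fun χ => ⟨ext χ, hext χ⟩) (fun χ _ => ?_) ?_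
  · rw [Finset.mem_coe, mem_rootedMaps]
    simp [ext, hab.symm]
  · intro χ _ χ' _ h
    ext z
    have h1 : ext χ z.1 = ext χ' z.1 := congrFun (congrArg DFunLike.coe h) z.1
    simp only [ext, z.2, not_false_eq_true, dif_pos] at h1
    exact congrArg Fin.val h1

theorem one_sub_le_card_rootedMaps {a b : Fin m} (hab : a ≠ b) {u v : Fin n} (huv : u ≠ v)
    (hmn : m ≤ n) :
    1 - (m : ℝ) ^ 2 / n ≤ ((n : ℝ) ^ (m - 2))⁻¹ * (rootedMaps n a b u v).card := by
  have hm : 2 ≤ m := by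
    have := Finset.card_le_univ ({a, b} : Finset (Fin m))
    rwa [Finset.card_pair hab, Fintype.card_fin] at this
  have hn : (0 : ℝ) < n := by exact_mod_cast (by omega : 0 < n)
  have h1 : (n + 1 - m) ^ (m - 2) ≤ (rootedMaps n a b u v).card := by
    refine le_trans ?_ (descFactorial_le_card_rootedMaps hab huv)
    have := Nat.pow_sub_le_descFactorial (n - 2) (m - 2)
    rwa [show n - 2 + 1 - (m - 2) = n + 1 - m by omega] at this
  have h2 : ((n : ℝ) - m) ^ (m - 2) ≤ (rootedMaps n a b u v).card := by
    refine le_trans ?_ (Nat.cast_le.2 h1)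
    have hmn' : (m : ℝ) ≤ n := by exact_mod_cast hmn
    rw [Nat.cast_pow, Nat.cast_sub (by omega)]
    push_cast
    exact pow_le_pow_left₀ (by linarith) (by linarith) _
  have hratio : (m : ℝ) / n ≤ 1 := (div_le_one hn).2 (by exact_mod_cast hmn)
  have h3 := one_add_mul_le_pow (a := -((m : ℝ) / n)) (by linarith) (m - 2)
  have h4 : ((n : ℝ) ^ (m - 2))⁻¹ * ((n : ℝ) - m) ^ (m - 2) = (1 + -((m : ℝ) / n)) ^ (m - 2) := by
    rw [← inv_pow, ← mul_pow]
    congr 1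
    field_simp
    ring
  have h5 : ((m - 2 : ℕ) : ℝ) * ((m : ℝ) / n) ≤ (m : ℝ) ^ 2 / n := by
    rw [sq, mul_div_assoc]
    gcongr
    omega
  calc 1 - (m : ℝ) ^ 2 / n ≤ 1 + ((m - 2 : ℕ) : ℝ) * -((m : ℝ) / n) := by linarith
    _ ≤ _ := h3
    _ = ((n : ℝ) ^ (m - 2))⁻¹ * ((n : ℝ) - m) ^ (m - 2) := h4.symm
    _ ≤ _ := by gcongr

end Counting

section Deviations

theorem Phi_pos (u : ℝ) : 0 < Phi u := by unfold Phi; positivity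

theorem Phi_lt_one (u : ℝ) : Phi u < 1 := by
  unfold Phi
  rw [div_lt_one (by positivity)]
  linarith

theorem Phi_mono : Monotone Phi := fun u v h => by
  have := Real.exp_le_exp.2 h
  unfold Phi
  rw [div_le_div_iff₀ (by positivity) (by positivity)]
  linarith

theorem abs_Phi_sub_le (u v : ℝ) : |Phi u - Phi v| ≤ |u - v| := by
  have hu := Real.exp_pos u
  have hv := Real.exp_pos v
  have h : Phi u - Phi v
      = (Real.exp u - Real.exp v) / ((1 + Real.exp u) * (1 + Real.exp v)) := by
    unfold Phi
    field_simp
    ring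
  rw [h, abs_div, abs_of_pos (by positivity : 0 < (1 + Real.exp u) * (1 + Real.exp v)),
    div_le_iff₀ (by positivity)]
  refine (abs_exp_sub_exp_le u v).trans (mul_le_mul_of_nonneg_left ?_ (abs_nonneg _))
  nlinarith [mul_pos hu hv]

variable {m n : ℕ}

theorem inv_pow_mul_card_hit_le {A : Finset (EdgeSet m)} {a b : Fin m} (hab : a ≠ b)
    (hA : ∀ f ∈ A, f.1 ≠ s(a, b)) (u v : Fin n) (e : EdgeSet n) :
    ((n : ℝ) ^ (m - 2))⁻¹
      * ((rootedMaps n a b u v).filter fun ψ => ∃ f ∈ A, mapEdge ψ f = e).card ≤ m / n := by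
  have hn : (0 : ℝ) < n := by exact_mod_cast u.pos
  have h := card_rootedMaps_hit_le hab hA u v e
  rw [inv_mul_eq_div, div_le_div_iff₀ (by positivity) hn]
  exact_mod_cast h

theorem inv_pow_mul_card_rootedMaps_le {a b : Fin m} (hab : a ≠ b) (u v : Fin n) :
    ((n : ℝ) ^ (m - 2))⁻¹ * (rootedMaps n a b u v).card ≤ 1 := by
  have hn : (0 : ℝ) < n := by exact_mod_cast u.pos
  rw [inv_mul_eq_div, div_le_one (by positivity)]
  exact_mod_cast card_rootedMaps_le hab u v

theorem abs_rootedDensity_update_sub_le {A : Finset (EdgeSet m)} {a b : Fin m} (hab : a ≠ b)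
    (hA : ∀ f ∈ A, f.1 ≠ s(a, b)) (u v : Fin n) (e : EdgeSet n) (x : Config n) :
    |rootedDensity A a b u v (Function.update x e true)
      - rootedDensity A a b u v (Function.update x e false)| ≤ m / n := by
  refine le_trans ?_ (inv_pow_mul_card_hit_le hab hA u v e)
  rw [rootedDensity, rootedDensity, ← mul_sub, ← Finset.sum_sub_distrib, abs_mul,
    abs_of_nonneg (by positivity : 0 ≤ ((n : ℝ) ^ (m - 2))⁻¹), Finset.card_filter, Nat.cast_sum]
  refine mul_le_mul_of_nonneg_left ?_ (by positivity)
  refine (Finset.abs_sum_le_sum_abs _ _).trans (Finset.sum_le_sum fun ψ _ => ?_)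
  split_ifs with h
  · rw [abs_le]
    have h1 := copyInd_nonneg A ψ (Function.update x e true)
    have h2 := copyInd_nonneg A ψ (Function.update x e false)
    have h3 := copyInd_le_one A ψ (Function.update x e true)
    have h4 := copyInd_le_one A ψ (Function.update x e false)
    push_cast
    constructor <;> linarith
  · push Not at h
    rw [copyInd_update_of_forall_ne h, copyInd_update_of_forall_ne h]
    simp

/-- A bound for the second discrete derivatives of the Hamiltonian, up to a factor `1 / n`. -/
noncomputable def hamiltonianBound {s : ℕ} (V : Fin s → ℕ) (β : Fin s → ℝ) : ℝ :=
  ∑ i, β i * (V i : ℝ) ^ 3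

variable {s : ℕ} {V : Fin s → ℕ} {β : Fin s → ℝ}

theorem hamiltonianBound_nonneg (hβ : ∀ i, 0 < β i) : 0 ≤ hamiltonianBound V β :=
  Finset.sum_nonneg fun i _ => mul_nonneg (hβ i).le (by positivity)

theorem abs_dHam_update_sub_le (G : ∀ i, SimpleGraph (Fin (V i))) (hβ : ∀ i, 0 < β i)
    (e f : EdgeSet n) (x : Config n) :
    |dHam V G β f (Function.update x e true) - dHam V G β f (Function.update x e false)|
      ≤ hamiltonianBound V β / n := by
  classical
  obtain ⟨u, v, huv⟩ : ∃ u v, f.1 = s(u, v) := by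
    obtain ⟨f, hf⟩ := f
    induction f using Sym2.ind with
    | _ u v => exact ⟨u, v, rfl⟩
  rw [dHam_eq V G β huv, dHam_eq V G β huv, ← Finset.sum_sub_distrib, hamiltonianBound,
    Finset.sum_div]
  refine (Finset.abs_sum_le_sum_abs _ _).trans (Finset.sum_le_sum fun i _ => ?_)
  rw [← mul_sub, abs_mul, abs_of_pos (hβ i), mul_div_assoc]
  refine mul_le_mul_of_nonneg_left ?_ (hβ i).le
  rw [← Finset.sum_sub_distrib]
  have h : ∀ a b : Fin (V i),
      |(if (G i).Adj a b then
          rootedDensity (otherEdges (G i) a b) a b u v (Function.update x e true) else 0)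
        - (if (G i).Adj a b then
          rootedDensity (otherEdges (G i) a b) a b u v (Function.update x e false) else 0)|
      ≤ (V i : ℝ) / n := fun a b => by
    split_ifs with hab
    · exact abs_rootedDensity_update_sub_le hab.ne (fun _ => ne_of_mem_otherEdges) u v e x
    · rw [sub_self, abs_zero]; positivity
  calc _ ≤ ∑ _a : Fin (V i), ∑ _b : Fin (V i), (V i : ℝ) / n := by
        refine (Finset.abs_sum_le_sum_abs _ _).trans (Finset.sum_le_sum fun a _ => ?_)
        rw [← Finset.sum_sub_distrib]
        exact (Finset.abs_sum_le_sum_abs _ _).trans (Finset.sum_le_sum fun b _ => h a b)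
    _ = (V i : ℝ) ^ 3 / n := by
        simp only [Finset.sum_const, Finset.card_univ, Fintype.card_fin, nsmul_eq_mul]
        ring

/-- The deviation between the normalised rooted count of `A` and the same count in which the
indicator of the edge `f` is replaced by its conditional probability. -/
noncomputable def deviation (V : Fin s → ℕ) (G : ∀ i, SimpleGraph (Fin (V i))) (β : Fin s → ℝ)
    (A : Finset (EdgeSet m)) (f : EdgeSet m) (a b : Fin m) (u v : Fin n) (x : Config n) : ℝ :=
  ((n : ℝ) ^ (m - 2))⁻¹ * ∑ ψ ∈ rootedMaps n a b u v, copyInd (A.erase f) ψ x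
    * (edgeX (mapEdge ψ f) x - Phi (dHam V G β (mapEdge ψ f) x))

theorem abs_deviation_update_sub_le (G : ∀ i, SimpleGraph (Fin (V i))) (hβ : ∀ i, 0 < β i)
    {A : Finset (EdgeSet m)} {f : EdgeSet m} (hf : f ∈ A) {a b : Fin m} (hab : a ≠ b)
    (hA : ∀ f ∈ A, f.1 ≠ s(a, b)) (u v : Fin n) (e : EdgeSet n) (x : Config n) :
    |deviation V G β A f a b u v (Function.update x e true)
      - deviation V G β A f a b u v (Function.update x e false)|
      ≤ (2 * m + hamiltonianBound V β) / n := by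
  have hκ : 0 ≤ ((n : ℝ) ^ (m - 2))⁻¹ := by positivity
  have hL : 0 ≤ hamiltonianBound V β / n :=
    div_nonneg (hamiltonianBound_nonneg hβ) (Nat.cast_nonneg _)
  rw [deviation, deviation, ← mul_sub, ← Finset.sum_sub_distrib, abs_mul, abs_of_nonneg hκ]
  have hterm : ∀ (ψ : Fin m ↪ Fin n) (y : Config n), |copyInd (A.erase f) ψ y
      * (edgeX (mapEdge ψ f) y - Phi (dHam V G β (mapEdge ψ f) y))| ≤ 1 := fun ψ y => by
    rw [abs_mul, abs_of_nonneg (copyInd_nonneg _ _ _)]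
    refine mul_le_one₀ (copyInd_le_one _ _ _) (abs_nonneg _) ?_
    rw [abs_le]
    have h1 := edgeX_nonneg (mapEdge ψ f) y
    have h2 := edgeX_le_one (mapEdge ψ f) y
    have h3 := Phi_pos (dHam V G β (mapEdge ψ f) y)
    have h4 := Phi_lt_one (dHam V G β (mapEdge ψ f) y)
    constructor <;> linarith
  have hdiff : ∀ ψ : Fin m ↪ Fin n,
      |copyInd (A.erase f) ψ (Function.update x e true) * (edgeX (mapEdge ψ f)
            (Function.update x e true) - Phi (dHam V G β (mapEdge ψ f) (Function.update x e true)))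
        - copyInd (A.erase f) ψ (Function.update x e false) * (edgeX (mapEdge ψ f)
            (Function.update x e false)
            - Phi (dHam V G β (mapEdge ψ f) (Function.update x e false)))|
      ≤ hamiltonianBound V β / n + 2 * ((if ∃ f ∈ A, mapEdge ψ f = e then 1 else 0 : ℕ) : ℝ) := by
    intro ψ
    split_ifs with h
    · refine (abs_sub _ _).trans ?_
      have h1 := hterm ψ (Function.update x e true)
      have h2 := hterm ψ (Function.update x e false)
      push_cast
      linarith
    · push Not at h
      have h' : ∀ g ∈ A.erase f, mapEdge ψ g ≠ e := fun g hg => h g (Finset.mem_of_mem_erase hg)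
      rw [copyInd_update_of_forall_ne h', copyInd_update_of_forall_ne h',
        edgeX_update_of_ne (h f hf), edgeX_update_of_ne (h f hf), ← mul_sub, abs_mul,
        abs_of_nonneg (copyInd_nonneg _ _ _), sub_sub_sub_cancel_left, abs_sub_comm]
      have h1 := (abs_Phi_sub_le _ _).trans (abs_dHam_update_sub_le G hβ e (mapEdge ψ f) x)
      have h2 := mul_le_mul (copyInd_le_one (A.erase f) ψ x) h1 (abs_nonneg _) zero_le_one
      simpa using h2
  calc _ ≤ ((n : ℝ) ^ (m - 2))⁻¹ * ∑ ψ ∈ rootedMaps n a b u v, (hamiltonianBound V β / n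
        + 2 * ((if ∃ f ∈ A, mapEdge ψ f = e then 1 else 0 : ℕ) : ℝ)) :=
        mul_le_mul_of_nonneg_left ((Finset.abs_sum_le_sum_abs _ _).trans
          (Finset.sum_le_sum fun ψ _ => hdiff ψ)) hκ
    _ = (((n : ℝ) ^ (m - 2))⁻¹ * (rootedMaps n a b u v).card) * (hamiltonianBound V β / n)
        + 2 * (((n : ℝ) ^ (m - 2))⁻¹
          * ((rootedMaps n a b u v).filter fun ψ => ∃ f ∈ A, mapEdge ψ f = e).card) := by
        rw [Finset.sum_add_distrib, Finset.sum_const, nsmul_eq_mul, ← Finset.mul_sum,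
          Finset.card_filter, Nat.cast_sum]
        ring
    _ ≤ 1 * (hamiltonianBound V β / n) + 2 * (m / n) := by
        gcongr
        · exact inv_pow_mul_card_rootedMaps_le hab u v
        · exact inv_pow_mul_card_hit_le hab hA u v e
    _ = _ := by ring

theorem ergmProb_nonneg (V : Fin s → ℕ) (G : ∀ i, SimpleGraph (Fin (V i))) (β : Fin s → ℝ)
    (x : Config n) : 0 ≤ ergmProb V G β x := by
  unfold ergmProb; positivity

theorem sum_ergmProb (V : Fin s → ℕ) (G : ∀ i, SimpleGraph (Fin (V i))) (β : Fin s → ℝ) :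
    ∑ x : Config n, ergmProb V G β x = 1 := by
  simp only [ergmProb]
  rw [← Finset.sum_div, div_self]
  exact (Finset.sum_pos (fun _ _ => Real.exp_pos _) Finset.univ_nonempty).ne'

theorem isCondProb_ergmProb (V : Fin s → ℕ) (G : ∀ i, SimpleGraph (Fin (V i))) (β : Fin s → ℝ) :
    IsCondProb (ergmProb (n := n) V G β) fun e x => Phi (dHam V G β e x) where
  nonneg _ _ := (Phi_pos _).le
  le_one _ _ := (Phi_lt_one _).le
  update e x b := by simp only [dHam, Function.update_idem]
  balance e x := by
    simp only [ergmProb, Phi, dHam, Real.exp_sub]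
    set u := Real.exp (Hamiltonian V G β (Function.update x e true))
    set v := Real.exp (Hamiltonian V G β (Function.update x e false))
    have hu : 0 < u := Real.exp_pos _
    have hv : 0 < v := Real.exp_pos _
    have : 1 + u / v ≠ 0 := by positivity
    field_simp
    ring

theorem isCondProb_erProb {p : ℝ} (hp0 : 0 ≤ p) (hp1 : p ≤ 1) :
    IsCondProb (erProb (n := n) p) fun _ _ => p where
  nonneg _ _ := hp0
  le_one _ _ := hp1
  update _ _ _ := rfl
  balance e x := by
    have h : ∀ b, erProb p (Function.update x e b) = (if b = true then p else 1 - p)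
        * ∏ f ∈ Finset.univ.erase e, if x f = true then p else 1 - p := fun b => by
      rw [erProb, ← Finset.mul_prod_erase Finset.univ _ (Finset.mem_univ e),
        Function.update_self]
      congr 1
      refine Finset.prod_congr rfl fun f hf => ?_
      rw [Function.update_of_ne (Finset.ne_of_mem_erase hf)]
    rw [h, h]
    simp only [if_true, Bool.false_eq_true, if_false]
    ring

theorem erProb_nonneg {p : ℝ} (hp0 : 0 ≤ p) (hp1 : p ≤ 1) (x : Config n) : 0 ≤ erProb p x :=
  Finset.prod_nonneg fun e _ => by split_ifs <;> linarith

theorem sum_erProb (p : ℝ) : ∑ x : Config n, erProb p x = 1 := by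
  have h := Finset.prod_univ_sum (fun _ : EdgeSet n => (Finset.univ : Finset Bool))
    (fun _ b => if b = true then p else 1 - p)
  rw [Fintype.piFinset_univ] at h
  simp only [erProb]
  rw [← h]
  simp

theorem sum_ergmProb_mul_exp_deviation_le (G : ∀ i, SimpleGraph (Fin (V i)))
    (hβ : ∀ i, 0 < β i) {A : Finset (EdgeSet m)} {f : EdgeSet m} (hf : f ∈ A) {a b : Fin m}
    (hab : a ≠ b) (hA : ∀ f ∈ A, f.1 ≠ s(a, b)) (u v : Fin n) (θ : ℝ) :
    ∑ x, ergmProb V G β x * Real.exp (θ * deviation V G β A f a b u v x)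
      ≤ Real.exp ((2 * m + hamiltonianBound V β) / n * θ ^ 2 / 2) :=
  sum_mul_exp_le (ergmProb_nonneg V G β) (sum_ergmProb V G β) (isCondProb_ergmProb V G β)
    (rootedMaps n a b u v) (by positivity) (inv_pow_mul_card_rootedMaps_le hab u v)
    (fun ψ => mapEdge ψ f) (copyInd_nonneg (A.erase f)) (copyInd_le_one (A.erase f))
    (fun _ _ x b => copyInd_erase_update x b) (fun _ => rfl)
    (div_nonneg (by linarith [hamiltonianBound_nonneg (V := V) hβ, (Nat.cast_nonneg m : (0:ℝ) ≤ m)])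
      (Nat.cast_nonneg _))
    (abs_deviation_update_sub_le G hβ hf hab hA u v) θ

end Deviations

section FixedPoint

variable {m n s : ℕ} {V : Fin s → ℕ} {β : Fin s → ℝ}

/-- In the sub-critical phase the map `φ_β` moves points towards `p` at a linear rate. -/
theorem Subcritical.exists_gap {G : ∀ i, SimpleGraph (Fin (V i))} {p : ℝ}
    (hsub : Subcritical V G β p) :
    ∃ c : ℝ, 0 < c ∧ ∀ t : ℝ, 0 ≤ t → t ≤ 1 →
      (t ≤ p → c * (p - t) ≤ phiFn V G β t - t) ∧ (p ≤ t → c * (t - p) ≤ t - phiFn V G β t) := by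
  obtain ⟨hfix, huniq, hderiv⟩ := hsub
  have hφ : Differentiable ℝ (phiFn V G β) := by
    have hΨ : Differentiable ℝ (Psi V G β) := by unfold Psi; fun_prop
    have : phiFn V G β = fun t => Real.exp (Psi V G β t) / (1 + Real.exp (Psi V G β t)) := rfl
    rw [this]
    exact hΨ.exp.div (hΨ.exp.const_add 1) fun t => by positivity
  set h : ℝ → ℝ := fun t => t - phiFn V G β t with hh
  have hhd : Differentiable ℝ h := differentiable_id.sub hφ
  have hp : h p = 0 := by simp [hh, hfix]
  have hcont : Continuous (dslope h p) := by
    rw [← continuousOn_univ]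
    exact (continuousOn_dslope Filter.univ_mem).2 ⟨hhd.continuous.continuousOn, hhd p⟩
  have hmul : ∀ t, (t - p) * dslope h p t = h t := fun t => by
    have := sub_smul_dslope h p t
    simpa [hp] using this
  have hpos_p : 0 < dslope h p p := by
    have : HasDerivAt h (1 - deriv (phiFn V G β) p) p :=
      (hasDerivAt_id p).sub (hφ p).hasDerivAt
    rw [dslope_same, this.deriv]
    linarith
  have hne : ∀ t, dslope h p t ≠ 0 := fun t ht => by
    have h1 := hmul t
    rw [ht, mul_zero] at h1
    have h2 : t = p := huniq t (by simp only [hh] at h1; linarith)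
    rw [h2] at ht
    exact hpos_p.ne' ht
  have hpos : ∀ t, 0 < dslope h p t := fun t => by
    by_contra hle
    obtain ⟨r, hr⟩ := mem_range_of_exists_le_of_exists_ge hcont ⟨t, not_lt.1 hle⟩ ⟨p, hpos_p.le⟩
    exact hne r hr
  obtain ⟨r, -, hr⟩ := isCompact_Icc.exists_isMinOn (Set.nonempty_Icc.2 (zero_le_one (α := ℝ)))
    hcont.continuousOn
  refine ⟨dslope h p r, hpos r, fun t ht0 ht1 => ?_⟩
  have h1 : dslope h p r ≤ dslope h p t := hr ⟨ht0, ht1⟩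
  have h2 := hmul t
  simp only [hh] at h1 h2 ⊢
  constructor <;> intro hpt <;> nlinarith

theorem rootedDensity_insert (G : ∀ i, SimpleGraph (Fin (V i))) {A : Finset (EdgeSet m)}
    {f : EdgeSet m} (hf : f ∉ A) (a b : Fin m) (u v : Fin n) (x : Config n) :
    rootedDensity (insert f A) a b u v x = deviation V G β (insert f A) f a b u v x
      + ((n : ℝ) ^ (m - 2))⁻¹ * ∑ ψ ∈ rootedMaps n a b u v,
        copyInd A ψ x * Phi (dHam V G β (mapEdge ψ f) x) := by
  rw [rootedDensity, deviation, ← mul_add, ← Finset.sum_add_distrib, Finset.erase_insert hf]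
  congr 1
  refine Finset.sum_congr rfl fun ψ _ => ?_
  rw [copyInd, Finset.prod_insert hf, ← copyInd]
  ring

theorem rootedDensity_empty (a b : Fin m) (u v : Fin n) (x : Config n) :
    rootedDensity ∅ a b u v x = ((n : ℝ) ^ (m - 2))⁻¹ * (rootedMaps n a b u v).card := by
  simp [rootedDensity, copyInd]

/-- All deviations of the configuration `x` are at most `D`. -/
def DeviationsLE (V : Fin s → ℕ) (G : ∀ i, SimpleGraph (Fin (V i))) (β : Fin s → ℝ)
    (D : ℝ) (x : Config n) : Prop :=
  ∀ (i : Fin s) (A : Finset (EdgeSet (V i))), ∀ f ∈ A, ∀ a b : Fin (V i), a ≠ b →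
    (∀ f ∈ A, f.1 ≠ s(a, b)) → ∀ u v : Fin n, u ≠ v → |deviation V G β A f a b u v x| ≤ D

theorem le_rootedDensity {G : ∀ i, SimpleGraph (Fin (V i))} {D δ t : ℝ} (hD : 0 ≤ D) (hδ : 0 ≤ δ)
    (ht0 : 0 ≤ t) (ht1 : t ≤ 1) {x : Config n} (hx : DeviationsLE V G β D x)
    (ht : ∀ e, t ≤ Phi (dHam V G β e x)) {i : Fin s} (hV : V i ≤ n)
    (hδV : (V i : ℝ) ^ 2 / n ≤ δ) {a b : Fin (V i)} (hab : a ≠ b) {u v : Fin n} (huv : u ≠ v)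
    (A : Finset (EdgeSet (V i))) (hA : ∀ f ∈ A, f.1 ≠ s(a, b)) :
    t ^ A.card - A.card * D - δ ≤ rootedDensity A a b u v x := by
  induction A using Finset.induction_on with
  | empty =>
    rw [rootedDensity_empty]
    have := one_sub_le_card_rootedMaps hab huv hV
    simp only [Finset.card_empty, pow_zero, Nat.cast_zero, zero_mul]
    linarith
  | insert f A hf ih =>
    have ih' := ih fun g hg => hA g (Finset.mem_insert_of_mem hg)
    have hdev := (abs_le.1 (hx i _ f (Finset.mem_insert_self f A) a b hab hA u v huv)).1
    have h1 : t * rootedDensity A a b u v x ≤ ((n : ℝ) ^ (V i - 2))⁻¹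
        * ∑ ψ ∈ rootedMaps n a b u v, copyInd A ψ x * Phi (dHam V G β (mapEdge ψ f) x) := by
      rw [rootedDensity, mul_left_comm, Finset.mul_sum]
      refine mul_le_mul_of_nonneg_left (Finset.sum_le_sum fun ψ _ => ?_) (by positivity)
      rw [mul_comm]
      exact mul_le_mul_of_nonneg_left (ht _) (copyInd_nonneg _ _ _)
    rw [rootedDensity_insert G hf, Finset.card_insert_of_notMem hf, pow_succ]
    push_cast
    have h2 := mul_le_mul_of_nonneg_left ih' ht0
    have h3 : t * (A.card * D + δ) ≤ A.card * D + δ :=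
      mul_le_of_le_one_left (by positivity) ht1
    linarith

theorem rootedDensity_le {G : ∀ i, SimpleGraph (Fin (V i))} {D t : ℝ} (hD : 0 ≤ D)
    (ht0 : 0 ≤ t) (ht1 : t ≤ 1) {x : Config n} (hx : DeviationsLE V G β D x)
    (ht : ∀ e, Phi (dHam V G β e x) ≤ t) {i : Fin s}
    {a b : Fin (V i)} (hab : a ≠ b) {u v : Fin n} (huv : u ≠ v)
    (A : Finset (EdgeSet (V i))) (hA : ∀ f ∈ A, f.1 ≠ s(a, b)) :
    rootedDensity A a b u v x ≤ t ^ A.card + A.card * D := by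
  induction A using Finset.induction_on with
  | empty =>
    rw [rootedDensity_empty]
    simpa using inv_pow_mul_card_rootedMaps_le hab u v
  | insert f A hf ih =>
    have ih' := ih fun g hg => hA g (Finset.mem_insert_of_mem hg)
    have hdev := (abs_le.1 (hx i _ f (Finset.mem_insert_self f A) a b hab hA u v huv)).2
    have h1 : ((n : ℝ) ^ (V i - 2))⁻¹ * ∑ ψ ∈ rootedMaps n a b u v,
        copyInd A ψ x * Phi (dHam V G β (mapEdge ψ f) x) ≤ t * rootedDensity A a b u v x := by
      rw [rootedDensity, mul_left_comm t, Finset.mul_sum _ _ t]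
      refine mul_le_mul_of_nonneg_left (Finset.sum_le_sum fun ψ _ => ?_) (by positivity)
      rw [mul_comm t]
      exact mul_le_mul_of_nonneg_left (ht _) (copyInd_nonneg _ _ _)
    rw [rootedDensity_insert G hf, Finset.card_insert_of_notMem hf, pow_succ]
    push_cast
    have h2 := mul_le_mul_of_nonneg_left ih' ht0
    have h3 : t * (A.card * D) ≤ A.card * D := mul_le_of_le_one_left (by positivity) ht1
    linarith

open scoped Classical in
theorem sum_sum_ite_adj (G : SimpleGraph (Fin m)) (c : ℝ) :
    (∑ a, ∑ b, if G.Adj a b then c else 0) = 2 * numEdges G * c := by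
  have h1 : ∀ a, (∑ b, if G.Adj a b then c else 0) = G.degree a * c := fun a => by
    rw [← Finset.sum_filter, Finset.sum_const, nsmul_eq_mul,
      ← SimpleGraph.card_neighborFinset_eq_degree, SimpleGraph.neighborFinset_eq_filter]
  simp_rw [h1, ← Finset.sum_mul]
  rw [← Nat.cast_sum, SimpleGraph.sum_degrees_eq_twice_card_edges, numEdges,
    ← SimpleGraph.coe_edgeFinset, Set.ncard_coe_finset]
  push_cast
  ring

/-- The constant in the comparison of `∂_e H` with `Ψ_β`. -/
noncomputable def comparisonConst (V : Fin s → ℕ) (G : ∀ i, SimpleGraph (Fin (V i)))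
    (β : Fin s → ℝ) : ℝ :=
  ∑ i, β i * (2 * numEdges (G i) * (numEdges (G i) + 1))

theorem comparisonConst_nonneg (G : ∀ i, SimpleGraph (Fin (V i))) (hβ : ∀ i, 0 < β i) :
    0 ≤ comparisonConst V G β :=
  Finset.sum_nonneg fun i _ => mul_nonneg (hβ i).le (by positivity)

theorem exists_ends (e : EdgeSet n) : ∃ u v : Fin n, u ≠ v ∧ e.1 = s(u, v) := by
  obtain ⟨e, he⟩ := e
  induction e using Sym2.ind with
  | _ u v => exact ⟨u, v, by simpa using he, rfl⟩

theorem Psi_sub_le_dHam {G : ∀ i, SimpleGraph (Fin (V i))} (hβ : ∀ i, 0 < β i) {D δ t : ℝ}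
    (hD : 0 ≤ D) (hδ : 0 ≤ δ) (ht0 : 0 ≤ t) (ht1 : t ≤ 1) {x : Config n}
    (hx : DeviationsLE V G β D x) (ht : ∀ e, t ≤ Phi (dHam V G β e x)) (hV : ∀ i, V i ≤ n)
    (hδV : ∀ i, (V i : ℝ) ^ 2 / n ≤ δ) (e : EdgeSet n) :
    Psi V G β t - comparisonConst V G β * (D + δ) ≤ dHam V G β e x := by
  classical
  obtain ⟨u, v, huv, he⟩ := exists_ends e
  rw [dHam_eq V G β he, Psi, comparisonConst, Finset.sum_mul, ← Finset.sum_sub_distrib]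
  refine Finset.sum_le_sum fun i _ => ?_
  have h : ∀ a b, (if (G i).Adj a b then
      t ^ (numEdges (G i) - 1) - (numEdges (G i) + 1) * (D + δ) else 0)
      ≤ if (G i).Adj a b then rootedDensity (otherEdges (G i) a b) a b u v x else 0 := by
    intro a b
    split_ifs with hab
    · refine le_trans ?_ (le_rootedDensity hD hδ ht0 ht1 hx ht (hV i) (hδV i) hab.ne huv _
        fun _ => ne_of_mem_otherEdges)
      rw [card_otherEdges hab]
      have h1 : ((numEdges (G i) - 1 : ℕ) : ℝ) ≤ numEdges (G i) :=
        Nat.cast_le.2 (Nat.sub_le _ _)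
      have h2 : (0 : ℝ) ≤ numEdges (G i) := Nat.cast_nonneg _
      nlinarith [mul_le_mul_of_nonneg_right h1 hD, mul_nonneg h2 hδ]
    · exact le_rfl
  have h' := Finset.sum_le_sum fun a (_ : a ∈ Finset.univ) =>
    Finset.sum_le_sum fun b (_ : b ∈ Finset.univ) => h a b
  rw [sum_sum_ite_adj] at h'
  have h'' := mul_le_mul_of_nonneg_left h' (hβ i).le
  linarith

theorem dHam_le_Psi_add {G : ∀ i, SimpleGraph (Fin (V i))} (hβ : ∀ i, 0 < β i) {D t : ℝ}
    (hD : 0 ≤ D) (ht0 : 0 ≤ t) (ht1 : t ≤ 1) {x : Config n}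
    (hx : DeviationsLE V G β D x) (ht : ∀ e, Phi (dHam V G β e x) ≤ t) (e : EdgeSet n) :
    dHam V G β e x ≤ Psi V G β t + comparisonConst V G β * D := by
  classical
  obtain ⟨u, v, huv, he⟩ := exists_ends e
  rw [dHam_eq V G β he, Psi, comparisonConst, Finset.sum_mul, ← Finset.sum_add_distrib]
  refine Finset.sum_le_sum fun i _ => ?_
  have h : ∀ a b, (if (G i).Adj a b then rootedDensity (otherEdges (G i) a b) a b u v x else 0)
      ≤ if (G i).Adj a b then
      t ^ (numEdges (G i) - 1) + (numEdges (G i) + 1) * D else 0 := by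
    intro a b
    split_ifs with hab
    · refine (rootedDensity_le hD ht0 ht1 hx ht hab.ne huv _
        fun _ => ne_of_mem_otherEdges).trans ?_
      rw [card_otherEdges hab]
      have h1 : ((numEdges (G i) - 1 : ℕ) : ℝ) ≤ numEdges (G i) :=
        Nat.cast_le.2 (Nat.sub_le _ _)
      nlinarith [mul_le_mul_of_nonneg_right h1 hD]
    · exact le_rfl
  have h' := Finset.sum_le_sum fun a (_ : a ∈ Finset.univ) =>
    Finset.sum_le_sum fun b (_ : b ∈ Finset.univ) => h a b
  rw [sum_sum_ite_adj] at h'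
  have h'' := mul_le_mul_of_nonneg_left h' (hβ i).le
  linarith

/-- If all deviations are small, then all conditional edge probabilities are close to `p`. -/
theorem abs_Phi_dHam_sub_le {G : ∀ i, SimpleGraph (Fin (V i))} (hβ : ∀ i, 0 < β i) {p c : ℝ}
    (hc : 0 < c) (hgap : ∀ t : ℝ, 0 ≤ t → t ≤ 1 →
      (t ≤ p → c * (p - t) ≤ phiFn V G β t - t) ∧ (p ≤ t → c * (t - p) ≤ t - phiFn V G β t))
    {D δ : ℝ} (hD : 0 ≤ D) (hδ : 0 ≤ δ) {x : Config n} (hx : DeviationsLE V G β D x)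
    (hV : ∀ i, V i ≤ n) (hδV : ∀ i, (V i : ℝ) ^ 2 / n ≤ δ) (e : EdgeSet n) :
    |Phi (dHam V G β e x) - p| ≤ comparisonConst V G β / c * (D + δ) := by
  have hK := comparisonConst_nonneg G hβ
  have hnn : 0 ≤ comparisonConst V G β / c * (D + δ) := by positivity
  have hlow : p - Phi (dHam V G β e x) ≤ comparisonConst V G β / c * (D + δ) := by
    obtain ⟨f, -, hf⟩ := Finset.exists_min_image Finset.univ
      (fun e => Phi (dHam V G β e x)) ⟨e, Finset.mem_univ e⟩
    set t := Phi (dHam V G β f x) with htdef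
    have ht0 : 0 ≤ t := (Phi_pos _).le
    have ht1 : t ≤ 1 := (Phi_lt_one _).le
    have hte : t ≤ Phi (dHam V G β e x) := hf e (Finset.mem_univ e)
    refine (sub_le_sub_left hte p).trans ?_
    rcases le_total p t with hpt | hpt
    · linarith
    have h1 := Psi_sub_le_dHam hβ hD hδ ht0 ht1 hx (fun e => hf e (Finset.mem_univ e)) hV hδV f
    have h2 := Phi_mono h1
    have h3 := (abs_le.1 (abs_Phi_sub_le (Psi V G β t)
      (Psi V G β t - comparisonConst V G β * (D + δ)))).2
    rw [sub_sub_cancel, abs_of_nonneg (by positivity)] at h3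
    have h4 := (hgap t ht0 ht1).1 hpt
    simp only [phiFn] at h4
    rw [div_mul_eq_mul_div, le_div_iff₀ hc]
    linarith
  have hupp : Phi (dHam V G β e x) - p ≤ comparisonConst V G β / c * (D + δ) := by
    obtain ⟨f, -, hf⟩ := Finset.exists_max_image Finset.univ
      (fun e => Phi (dHam V G β e x)) ⟨e, Finset.mem_univ e⟩
    set t := Phi (dHam V G β f x) with htdef
    have ht0 : 0 ≤ t := (Phi_pos _).le
    have ht1 : t ≤ 1 := (Phi_lt_one _).le
    have hte : Phi (dHam V G β e x) ≤ t := hf e (Finset.mem_univ e)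
    refine (sub_le_sub_right hte p).trans ?_
    rcases le_total t p with hpt | hpt
    · linarith
    have h1 := dHam_le_Psi_add hβ hD ht0 ht1 hx (fun e => hf e (Finset.mem_univ e)) f
    have h2 := Phi_mono h1
    have h3 := (abs_le.1 (abs_Phi_sub_le (Psi V G β t + comparisonConst V G β * D)
      (Psi V G β t))).2
    rw [add_sub_cancel_left, abs_of_nonneg (by positivity)] at h3
    have h4 := (hgap t ht0 ht1).2 hpt
    simp only [phiFn] at h4
    rw [div_mul_eq_mul_div, le_div_iff₀ hc]
    nlinarith [mul_nonneg hK hδ]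
  exact abs_le.2 ⟨by linarith, hupp⟩

end FixedPoint

section Assembly

/-- Pattern data of a deviation: two roots, a set of edges and a distinguished edge. -/
abbrev Pattern {s : ℕ} (V : Fin s → ℕ) : Type :=
  Σ i, (Fin (V i) × Fin (V i)) × Finset (EdgeSet (V i)) × EdgeSet (V i)

variable {s n : ℕ} {V : Fin s → ℕ} {β : Fin s → ℝ}

/-- All deviations are dominated by a single function of small mean. -/
theorem exists_deviation_majorant (G : ∀ i, SimpleGraph (Fin (V i))) (hβ : ∀ i, 0 < β i)
    (n : ℕ) {θ : ℝ} (hθ : 0 < θ) :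
    ∃ D : Config n → ℝ, (∀ x, 0 ≤ D x) ∧ (∀ x, DeviationsLE V G β (D x) x) ∧
      ∑ x, ergmProb V G β x * D x ≤ Real.log (1 + 2 * (Fintype.card (Pattern V) * (n : ℝ) ^ 2)
        * Real.exp ((2 * (∑ i, V i : ℕ) + hamiltonianBound V β) / n * θ ^ 2 / 2)) / θ := by
  classical
  let Valid : Pattern V × (Fin n × Fin n) → Prop := fun j =>
    j.1.2.2.2 ∈ j.1.2.2.1 ∧ j.1.2.1.1 ≠ j.1.2.1.2 ∧
      ∀ g ∈ j.1.2.2.1, g.1 ≠ s(j.1.2.1.1, j.1.2.1.2)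
  let F : Pattern V × (Fin n × Fin n) → Config n → ℝ := fun j x =>
    if Valid j then
      deviation V G β j.1.2.2.1 j.1.2.2.2 j.1.2.1.1 j.1.2.1.2 j.2.1 j.2.2 x
    else 0
  have hL := hamiltonianBound_nonneg (V := V) hβ
  have hF : ∀ j τ, τ ^ 2 = θ ^ 2 → ∑ x, ergmProb V G β x * Real.exp (τ * F j x)
      ≤ Real.exp ((2 * (∑ i, V i : ℕ) + hamiltonianBound V β) / n * θ ^ 2 / 2) := by
    intro j τ hτ
    by_cases hj : Valid j
    · simp only [F, if_pos hj]
      refine (sum_ergmProb_mul_exp_deviation_le G hβ hj.1 hj.2.1 hj.2.2 j.2.1 j.2.2 τ).trans ?_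
      rw [hτ]
      have hm : ((V j.1.1 : ℕ) : ℝ) ≤ ((∑ i, V i : ℕ) : ℝ) :=
        Nat.cast_le.2 (Finset.single_le_sum (f := V) (fun _ _ => Nat.zero_le _)
          (Finset.mem_univ _))
      gcongr
    · simp only [F, if_neg hj, mul_zero, Real.exp_zero, mul_one, sum_ergmProb]
      exact Real.one_le_exp (by positivity)
  obtain ⟨D, hD0, hD, hDs⟩ := exists_majorant (ergmProb_nonneg V G β) (sum_ergmProb V G β) F hθ
    (fun j => hF j θ rfl) (fun j => hF j (-θ) (neg_sq θ))
  refine ⟨D, hD0, fun x i A f hf a b hab hA u v _ => ?_, ?_⟩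
  · have hj : Valid (⟨i, (a, b), A, f⟩, (u, v)) := ⟨hf, hab, hA⟩
    have h := hD (⟨i, (a, b), A, f⟩, (u, v)) x
    simpa only [F, if_pos hj] using h
  · convert hDs using 6
    simp [Fintype.card_prod, sq]

theorem log_majorant_le {K C n : ℝ} (hK : 0 ≤ K) (hC : 0 ≤ C) (hn : 3 ≤ n) :
    Real.log (1 + 2 * (K * n ^ 2) * Real.exp (C / n * √(n * Real.log n) ^ 2 / 2))
        / √(n * Real.log n)
      ≤ (Real.log (1 + 2 * K) + 2 + C / 2) * (√(Real.log n) / √n) := by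
  have hn0 : 0 < n := by linarith
  have hlog : 1 ≤ Real.log n :=
    (Real.le_log_iff_exp_le hn0).2 (Real.exp_one_lt_d9.le.trans (by norm_num; linarith))
  have hl0 : 0 < Real.log n := by linarith
  have hB : C / n * √(n * Real.log n) ^ 2 / 2 = C / 2 * Real.log n := by
    rw [Real.sq_sqrt (by positivity)]
    field_simp
  rw [hB]
  have hE : 1 ≤ Real.exp (C / 2 * Real.log n) := Real.one_le_exp (by positivity)
  have h1 : 1 + 2 * (K * n ^ 2) * Real.exp (C / 2 * Real.log n)
      ≤ (1 + 2 * K) * (n ^ 2 * Real.exp (C / 2 * Real.log n)) := by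
    have : (1 : ℝ) ≤ n ^ 2 * Real.exp (C / 2 * Real.log n) :=
      one_le_mul_of_one_le_of_one_le (one_le_pow₀ (by linarith)) hE
    linarith
  have h2 : Real.log (1 + 2 * (K * n ^ 2) * Real.exp (C / 2 * Real.log n))
      ≤ (Real.log (1 + 2 * K) + 2 + C / 2) * Real.log n := by
    refine (Real.log_le_log (by positivity) h1).trans ?_
    rw [Real.log_mul (by positivity) (by positivity), Real.log_mul (by positivity) (by positivity),
      Real.log_exp, Real.log_pow]
    have h3 : 0 ≤ Real.log (1 + 2 * K) := Real.log_nonneg (by linarith)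
    push_cast
    nlinarith [mul_le_mul_of_nonneg_left hlog h3]
  rw [div_le_iff₀ (by positivity), Real.sqrt_mul hn0.le]
  refine h2.trans_eq ?_
  have hs : √n ≠ 0 := by positivity
  rw [mul_assoc, div_mul_comm, mul_comm √n, mul_div_assoc, div_self hs, mul_one,
    Real.mul_self_sqrt hl0.le]

theorem card_edgeSet_le (n : ℕ) : Fintype.card (EdgeSet n) ≤ n ^ 2 := by
  have h : Fintype.card (EdgeSet n) ≤ Fintype.card (Fin n × Fin n) :=
    Fintype.card_le_of_surjective (α := {q : Fin n × Fin n // ¬ (s(q.1, q.2) : Sym2 _).IsDiag})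
      (fun q => ⟨s(q.1.1, q.1.2), q.2⟩)
      (by rintro ⟨e, he⟩
          induction e using Sym2.ind with
          | _ a b => exact ⟨⟨(a, b), he⟩, rfl⟩) |>.trans (Fintype.card_subtype_le _)
  simpa [sq] using h

theorem sq_mul_sqrt_div_sqrt {n : ℝ} (hn : 0 < n) (a : ℝ) :
    n ^ 2 * (a / √n) = n ^ ((3 : ℝ) / 2) * a := by
  have h : n ^ ((3 : ℝ) / 2) * √n = n ^ 2 := by
    rw [Real.sqrt_eq_rpow, ← Real.rpow_add hn, ← Real.rpow_natCast]
    norm_num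
  rw [← h]
  have hs : √n ≠ 0 := by positivity
  field_simp

end Assembly

open scoped Classical in
/-- **Theorem (`W₁`-Wasserstein distance to Erdős–Rényi).**
If `β` is sub-critical with fixed point `p*`, there is `C > 0` such that for all
sufficiently large `n` there is a coupling `γ` of `ERGM(β)` and `G(n,p*)` with
`Σ_e ℙ_γ(X_e ≠ Y_e) ≤ C n^{3/2} √(log n)`; in particular
`W₁(π, ν) ≤ C n^{3/2} √(log n)`. -/
theorem wasserstein_to_erdos_renyi {s : ℕ} (V : Fin s → ℕ)
    (G : ∀ i, SimpleGraph (Fin (V i))) (β : Fin s → ℝ) (hβ : ∀ i, 0 < β i)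
    (p : ℝ) (hsub : Subcritical V G β p) :
    ∃ C : ℝ, 0 < C ∧ ∃ N : ℕ, ∀ n : ℕ, N ≤ n →
      ∃ γ : Config n × Config n → ℝ,
        (∀ q, 0 ≤ γ q) ∧
        (∀ x : Config n, ∑ y : Config n, γ (x, y) = ergmProb V G β x) ∧
        (∀ y : Config n, ∑ x : Config n, γ (x, y) = erProb p y) ∧
        (∑ e : EdgeSet n, ∑ q : Config n × Config n,
            (if q.1 e ≠ q.2 e then γ q else 0)) ≤
          C * (n : ℝ) ^ ((3 : ℝ) / 2) * Real.sqrt (Real.log n) := by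
  obtain ⟨c, hc, hgap⟩ := hsub.exists_gap
  have hp0 : 0 ≤ p := hsub.1 ▸ (Phi_pos _).le
  have hp1 : p ≤ 1 := hsub.1 ▸ (Phi_lt_one _).le
  set Vm : ℕ := ∑ i, V i
  set K₀ : ℝ := (Fintype.card (Pattern V) : ℝ)
  set C₀ : ℝ := 2 * (Vm : ℝ) + hamiltonianBound V β
  set C₁ : ℝ := Real.log (1 + 2 * K₀) + 2 + C₀ / 2
  set K : ℝ := comparisonConst V G β / c
  have hK₀ : 0 ≤ K₀ := Nat.cast_nonneg _
  have hC₀ : 0 ≤ C₀ := by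
    have := hamiltonianBound_nonneg (V := V) hβ
    positivity
  have hC₁ : 0 ≤ C₁ := by
    have : 0 ≤ Real.log (1 + 2 * K₀) := Real.log_nonneg (by linarith)
    positivity
  have hK : 0 ≤ K := div_nonneg (comparisonConst_nonneg G hβ) hc.le
  refine ⟨K * (C₁ + (Vm : ℝ) ^ 2) + 1, by positivity, max 3 Vm, fun n hn => ?_⟩
  have hn3 : (3 : ℝ) ≤ n := by exact_mod_cast (le_max_left _ _).trans hn
  have hn0 : (0 : ℝ) < n := by linarith
  have hlog : 1 ≤ Real.log n :=
    (Real.le_log_iff_exp_le hn0).2 (Real.exp_one_lt_d9.le.trans (by norm_num; linarith))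
  have hVle : ∀ i, V i ≤ Vm := fun i =>
    Finset.single_le_sum (f := V) (fun _ _ => Nat.zero_le _) (Finset.mem_univ i)
  obtain ⟨D, hD0, hD, hDs⟩ := exists_deviation_majorant G hβ n
    (θ := √(n * Real.log n)) (by positivity)
  have hmean := hDs.trans (log_majorant_le hK₀ hC₀ hn3)
  set r : ℝ := √(Real.log n) / √n
  have hδ : (Vm : ℝ) ^ 2 / n ≤ (Vm : ℝ) ^ 2 * r := by
    rw [div_eq_mul_inv]
    refine mul_le_mul_of_nonneg_left ?_ (by positivity)
    have h1 : 1 ≤ √n := Real.one_le_sqrt.2 (by linarith)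
    have h2 : 1 ≤ √(Real.log n) := Real.one_le_sqrt.2 hlog
    rw [inv_eq_one_div]
    refine div_le_div₀ (by positivity) h2 (by positivity) ?_
    nlinarith [Real.mul_self_sqrt hn0.le]
  obtain ⟨γ, hγ0, hγ1, hγ2, hγ⟩ := exists_coupling (ergmProb_nonneg V G β) (sum_ergmProb V G β)
    (erProb_nonneg hp0 hp1) (sum_erProb p) (isCondProb_ergmProb V G β)
    (isCondProb_erProb hp0 hp1) (ι := EdgeSet n)
  refine ⟨γ, hγ0, hγ1, hγ2, ?_⟩
  have hedge : ∀ e : EdgeSet n, ∑ x, ergmProb V G β x * |Phi (dHam V G β e x) - p|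
      ≤ K * (C₁ + (Vm : ℝ) ^ 2) * r := by
    intro e
    calc ∑ x, ergmProb V G β x * |Phi (dHam V G β e x) - p|
        ≤ ∑ x, ergmProb V G β x * (K * (D x + (Vm : ℝ) ^ 2 / n)) :=
          Finset.sum_le_sum fun x _ => mul_le_mul_of_nonneg_left
            (abs_Phi_dHam_sub_le hβ hc hgap (hD0 x) (by positivity) (hD x)
              (fun i => (hVle i).trans ((le_max_right _ _).trans hn))
              (fun i => by gcongr; exact hVle i) e)
            (ergmProb_nonneg V G β x)
      _ = K * (∑ x, ergmProb V G β x * D x + (Vm : ℝ) ^ 2 / n) := by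
          rw [Finset.sum_congr rfl fun x _ => mul_left_comm _ _ _, ← Finset.mul_sum]
          simp only [mul_add, Finset.sum_add_distrib, ← Finset.sum_mul, sum_ergmProb, one_mul]
      _ ≤ K * (C₁ * r + (Vm : ℝ) ^ 2 * r) :=
          mul_le_mul_of_nonneg_left (add_le_add hmean hδ) hK
      _ = K * (C₁ + (Vm : ℝ) ^ 2) * r := by ring
  have hcard : (Fintype.card (EdgeSet n) : ℝ) ≤ (n : ℝ) ^ 2 := by
    exact_mod_cast card_edgeSet_le n
  calc (∑ e : EdgeSet n, ∑ q : Config n × Config n, (if q.1 e ≠ q.2 e then γ q else 0))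
      ≤ ∑ _e : EdgeSet n, K * (C₁ + (Vm : ℝ) ^ 2) * r := Finset.sum_le_sum fun e _ => by
        convert (hγ e).trans (hedge e)
    _ = Fintype.card (EdgeSet n) * (K * (C₁ + (Vm : ℝ) ^ 2) * r) := by
        rw [Finset.sum_const, Finset.card_univ, nsmul_eq_mul]
    _ ≤ (n : ℝ) ^ 2 * ((K * (C₁ + (Vm : ℝ) ^ 2) + 1) * r) := by
        refine mul_le_mul hcard ?_ (by positivity) (by positivity)
        exact mul_le_mul_of_nonneg_right (by linarith) (by positivity)
    _ = (K * (C₁ + (Vm : ℝ) ^ 2) + 1) * (n : ℝ) ^ ((3 : ℝ) / 2) * √(Real.log n) := by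
        rw [mul_left_comm, sq_mul_sqrt_div_sqrt hn0, mul_assoc]

end ERGM
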